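/- Let Assumption (H) hold with E[‖A‖_HS^8] < ∞, ℙ(det A > 0) = 1 and E[‖A^{-1}‖_HS^2] < ∞. Then the relative entropy of F with respect to G satisfies D(F||G) ≤ (√3/(12√2))·(2√6+3√2+2+√d)·‖K^{-1}‖_HS^2·‖E[A]−K‖_HS^2 + (1/λ(K)^4)·{ 8‖K‖_HS·E[‖A^{-1}‖_HS^2]^{1/2} + 8‖K^{-1}‖_HS·E[‖A‖_HS^2]^{1/2} + (√2/√3)·(2√6+3√2+2+√d)·‖K^{-1}‖_HS^2·(λ(K)^2+4‖K‖_HS^2) + √70·d^2·( (1/2)·max{ |log(2^d det K/(2‖K‖_op+λ(K))^d)| , log(2^d det K/λ(K)^d) } + (√2+1)d/4 ) + (3 + √3/8 + 5√10 + 4√30/3 + √15/3 + 10√5/3)·d^2 }·E[‖A−K‖_HS^8]^{1/2}. -/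

import Mathlib

open MeasureTheory ProbabilityTheory Matrix

noncomputable section

/-- Euclidean norm on `Fin d → ℝ`. -/
def euclNorm {d : ℕ} (x : Fin d → ℝ) : ℝ := Real.sqrt (∑ i, x i ^ 2)

/-- Hilbert–Schmidt norm of a matrix. -/
def hsNorm {d : ℕ} (M : Matrix (Fin d) (Fin d) ℝ) : ℝ := Real.sqrt (∑ i, ∑ j, M i j ^ 2)

/-- Operator norm of a matrix (w.r.t. the Euclidean norm). -/
def opNorm {d : ℕ} (M : Matrix (Fin d) (Fin d) ℝ) : ℝ :=
  sSup {r : ℝ | ∃ x : Fin d → ℝ, euclNorm x = 1 ∧ r = euclNorm (M.mulVec x)}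

/-- Smallest eigenvalue of a symmetric matrix (as the infimum of the Rayleigh quotient). -/
def lambdaMin {d : ℕ} (M : Matrix (Fin d) (Fin d) ℝ) : ℝ :=
  sInf {r : ℝ | ∃ x : Fin d → ℝ, euclNorm x = 1 ∧ r = x ⬝ᵥ M.mulVec x}

/-- Density of the centered Gaussian law `N_d(0, M)` on `ℝ^d`. -/
def gaussDensity {d : ℕ} (M : Matrix (Fin d) (Fin d) ℝ) (x : Fin d → ℝ) : ℝ :=
  (Real.sqrt ((2 * Real.pi) ^ d * M.det))⁻¹ * Real.exp (-(1/2) * (x ⬝ᵥ M⁻¹.mulVec x))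

/-- The centered Gaussian law `N_d(0, M)` on `ℝ^d` (for `M` positive definite). -/
def gaussLaw {d : ℕ} (M : Matrix (Fin d) (Fin d) ℝ) : Measure (Fin d → ℝ) :=
  volume.withDensity fun x => ENNReal.ofReal (gaussDensity M x)

/-- Relative entropy (Kullback–Leibler divergence) of `μ` with respect to `ν`. -/
def relEnt {E : Type*} [MeasurableSpace E] (μ ν : Measure E) : ℝ :=
  ∫ x, Real.log ((μ.rnDeriv ν x).toReal) ∂μ

/-- `F` is a centered, integrable random vector which is conditionally Gaussian with respect to
the σ-field `𝓕`, with conditional covariance matrix `A`. -/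
def CondGaussian {Ω : Type*} [MeasurableSpace Ω] (P : Measure Ω) {d : ℕ}
    (F : Ω → Fin d → ℝ) (𝓕 : MeasurableSpace Ω)
    (A : Ω → Matrix (Fin d) (Fin d) ℝ) : Prop :=
  Integrable F P ∧ (∫ ω, F ω ∂P) = 0 ∧
  (∀ ω, (A ω).PosSemidef) ∧
  Measurable[𝓕] (fun ω i j => A ω i j) ∧
  ∀ y : Fin d → ℝ,
    P[(fun ω => Complex.exp (Complex.I * ((y ⬝ᵥ F ω : ℝ) : ℂ))) | 𝓕] =ᵐ[P]
      fun ω => ((Real.exp (-(1/2) * (y ⬝ᵥ (A ω).mulVec y)) : ℝ) : ℂ)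

/-- The dimensional constant `2√6 + 3√2 + 2 + √d`. -/
def Cfac (d : ℕ) : ℝ := 2 * Real.sqrt 6 + 3 * Real.sqrt 2 + 2 + Real.sqrt d

/-- `max{ |log(2^d det K/(2‖K‖_op + λ(K))^d)| , log(2^d det K/λ(K)^d) }`. -/
def maxLog {d : ℕ} (K : Matrix (Fin d) (Fin d) ℝ) : ℝ :=
  max |Real.log ((2 ^ d * K.det) / ((2 * opNorm K + lambdaMin K) ^ d))|
      (Real.log ((2 ^ d * K.det) / (lambdaMin K ^ d)))

end



section MatrixPart

variable {d : ℕ}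

section frob
open scoped Matrix.Norms.Frobenius

lemma hs_eq_norm (M : Matrix (Fin d) (Fin d) ℝ) : hsNorm M = ‖M‖ := by
  rw [Matrix.frobenius_norm_def, hsNorm, Real.sqrt_eq_rpow]
  congr 1
  simp

lemma hs_add_le (M N : Matrix (Fin d) (Fin d) ℝ) : hsNorm (M + N) ≤ hsNorm M + hsNorm N := by
  simp only [hs_eq_norm]; exact norm_add_le _ _

lemma hs_sub_le (M N : Matrix (Fin d) (Fin d) ℝ) : hsNorm (M - N) ≤ hsNorm M + hsNorm N := by
  simp only [hs_eq_norm]; exact norm_sub_le _ _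

lemma hs_mul_le (M N : Matrix (Fin d) (Fin d) ℝ) : hsNorm (M * N) ≤ hsNorm M * hsNorm N := by
  simp only [hs_eq_norm]; exact Matrix.frobenius_norm_mul _ _

lemma hs_transpose (M : Matrix (Fin d) (Fin d) ℝ) : hsNorm Mᵀ = hsNorm M := by
  simp only [hs_eq_norm]; exact Matrix.frobenius_norm_transpose _

end frob

lemma hs_nonneg (M : Matrix (Fin d) (Fin d) ℝ) : 0 ≤ hsNorm M := Real.sqrt_nonneg _

lemma hs_sq (M : Matrix (Fin d) (Fin d) ℝ) : hsNorm M ^ 2 = ∑ i, ∑ j, M i j ^ 2 := by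
  rw [hsNorm, Real.sq_sqrt]; positivity

lemma hs_sq_trace (M : Matrix (Fin d) (Fin d) ℝ) : hsNorm M ^ 2 = (M * Mᵀ).trace := by
  rw [hs_sq]; simp [Matrix.trace, Matrix.mul_apply, sq]

lemma abs_entry_le_hs (M : Matrix (Fin d) (Fin d) ℝ) (i j : Fin d) : |M i j| ≤ hsNorm M := by
  apply Real.abs_le_sqrt
  calc M i j ^ 2 ≤ ∑ j, M i j ^ 2 :=
        Finset.single_le_sum (f := fun j => M i j ^ 2) (fun _ _ => sq_nonneg _) (Finset.mem_univ j)
    _ ≤ _ := Finset.single_le_sum (f := fun i => ∑ j, M i j ^ 2)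
        (fun _ _ => Finset.sum_nonneg fun _ _ => sq_nonneg _) (Finset.mem_univ i)

lemma abs_trace_mul_le (M N : Matrix (Fin d) (Fin d) ℝ) :
    |(M * N).trace| ≤ hsNorm M * hsNorm N := by
  apply abs_le_of_sq_le_sq _ (mul_nonneg (hs_nonneg _) (hs_nonneg _))
  rw [mul_pow, ← hs_transpose N, hs_sq, hs_sq]
  have := Finset.sum_mul_sq_le_sq_mul_sq (Finset.univ : Finset (Fin d × Fin d))
    (fun p => M p.1 p.2) (fun p => Nᵀ p.1 p.2)
  simpa [Fintype.sum_prod_type, Matrix.trace, Matrix.mul_apply] using this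

lemma posDef_one_le_exp {S : Matrix (Fin d) (Fin d) ℝ} (hS : S.PosSemidef) :
    S.det ≤ Real.exp (S.trace - d) := by
  rw [hS.isHermitian.det_eq_prod_eigenvalues, hS.isHermitian.trace_eq_sum_eigenvalues]
  simp only [RCLike.ofReal_real_eq_id, id]
  have : (∑ i, hS.isHermitian.eigenvalues i - (d:ℝ)) = ∑ i, (hS.isHermitian.eigenvalues i - 1) := by
    simp
  rw [this, Real.exp_sum]
  apply Finset.prod_le_prod
  · intro i _; exact hS.eigenvalues_nonneg i
  · intro i _
    have := Real.add_one_le_exp (hS.isHermitian.eigenvalues i - 1)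
    linarith

lemma det_one_add_sq_le (N : Matrix (Fin d) (Fin d) ℝ) :
    (1 + N).det ^ 2 ≤ Real.exp (2 * N.trace + hsNorm N ^ 2) := by
  have h := posDef_one_le_exp (Matrix.posSemidef_self_mul_conjTranspose (1 + N))
  rw [Matrix.conjTranspose_eq_transpose_of_trivial, Matrix.det_mul, Matrix.det_transpose,
    ← sq] at h
  refine h.trans (le_of_eq ?_)
  congr 1
  rw [hs_sq_trace]
  simp [Matrix.add_mul, Matrix.mul_add, Matrix.trace_add]
  ring

/-- A symmetric square root. -/
lemma exists_sqrt {S : Matrix (Fin d) (Fin d) ℝ} (hS : S.PosDef) :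
    ∃ R : Matrix (Fin d) (Fin d) ℝ, Rᵀ = R ∧ R * R = S ∧ R.det ≠ 0 := by
  open scoped MatrixOrder in
  refine ⟨CFC.sqrt S, ?_, ?_, ?_⟩
  · have := (CFC.sqrt_nonneg S).posSemidef.isHermitian
    rwa [Matrix.IsHermitian, Matrix.conjTranspose_eq_transpose_of_trivial] at this
  · exact CFC.sqrt_mul_sqrt_self S hS.posSemidef.nonneg
  · intro h
    have := congrArg Matrix.det (CFC.sqrt_mul_sqrt_self S hS.posSemidef.nonneg)
    rw [Matrix.det_mul, h] at this
    have := hS.det_pos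
    linarith

lemma log_det_mul_inv_le {K A : Matrix (Fin d) (Fin d) ℝ} (hK : K.PosDef) (hA : A.PosDef) :
    Real.log K.det - Real.log A.det ≤ (K * A⁻¹).trace - d := by
  obtain ⟨R, hR, hRR, hRd⟩ := exists_sqrt hK
  have h := posDef_one_le_exp (hA.inv.posSemidef.conjTranspose_mul_mul_same R)
  rw [Matrix.conjTranspose_eq_transpose_of_trivial, hR, Matrix.trace_mul_cycle, hRR] at h
  have hdet : (R * A⁻¹ * R).det = K.det / A.det := by
    rw [Matrix.det_mul, Matrix.det_mul, mul_right_comm, ← Matrix.det_mul, hRR, Matrix.det_nonsing_inv,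
      Ring.inverse_eq_inv', div_eq_mul_inv]
  rw [hdet] at h
  rw [← Real.log_div hK.det_pos.ne' hA.det_pos.ne']
  calc _ ≤ Real.log (Real.exp ((K * A⁻¹).trace - d)) :=
        Real.log_le_log (div_pos hK.det_pos hA.det_pos) h
    _ = _ := Real.log_exp _

/-- the crucial determinant bound -/
lemma det_one_sub_bound (M : Matrix (Fin d) (Fin d) ℝ) (s : ℝ) (hs0 : 0 ≤ s) (hs : s ≤ 1/4)
    (hM : hsNorm M ≤ s) (htM : |M.trace| ≤ s) (hdet : 0 < (1 - M).det) :
    (Real.sqrt (1 - M).det)⁻¹ ≤ 1 + (1/2) * M.trace + 2 * s ^ 2 := by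
  have hu : IsUnit (1 - M).det := hdet.ne'.isUnit
  set N := M * (1 - M)⁻¹ with hN
  have h1 : 1 + N = (1 - M)⁻¹ := by
    have : (1 - M) * (1 - M)⁻¹ = 1 := Matrix.mul_nonsing_inv _ hu
    rw [Matrix.sub_mul, one_mul] at this
    rw [hN]; exact (sub_eq_iff_eq_add.1 this).symm
  have h2 : N = M + M * N := by
    rw [← mul_one_add (M) N, h1]
  have hNn : hsNorm N ≤ 4/3 * s := by
    have h3 : hsNorm N ≤ hsNorm M + hsNorm M * hsNorm N := by
      calc hsNorm N = hsNorm (M + M * N) := by rw [← h2]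
        _ ≤ _ := (hs_add_le _ _).trans (by gcongr; exact hs_mul_le _ _)
    have := hs_nonneg N
    nlinarith [mul_le_mul_of_nonneg_right hM this, mul_le_mul_of_nonneg_right hs this]
  have htr : N.trace ≤ M.trace + 4/3 * s ^ 2 := by
    have h3 : N.trace = M.trace + (M * N).trace := by
      conv_lhs => rw [h2]
      rw [Matrix.trace_add]
    have h4 := (le_abs_self _).trans (abs_trace_mul_le M N)
    have := mul_le_mul hM hNn (hs_nonneg _) hs0
    nlinarith
  have hdetle : ((1 - M).det)⁻¹ ^ 2 ≤ Real.exp (2 * N.trace + hsNorm N ^ 2) := by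
    have := det_one_add_sq_le N
    rwa [h1, Matrix.det_nonsing_inv, Ring.inverse_eq_inv'] at this
  set u := (1/2) * M.trace + 10/9 * s^2 with hudef
  have hle : ((1 - M).det)⁻¹ ^ 2 ≤ Real.exp u ^ 4 := by
    refine hdetle.trans ?_
    rw [← Real.exp_nat_mul]
    apply Real.exp_le_exp.2
    have : hsNorm N ^ 2 ≤ (4/3 * s)^2 := pow_le_pow_left₀ (hs_nonneg _) hNn 2
    push_cast
    nlinarith
  have hsq : (Real.sqrt (1 - M).det)⁻¹ ≤ Real.exp u := by
    have : ((Real.sqrt (1 - M).det)⁻¹) ^ 4 ≤ Real.exp u ^ 4 := by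
      refine le_trans (le_of_eq ?_) hle
      rw [inv_pow, inv_pow]
      congr 1
      rw [show 4 = 2 * 2 from rfl, pow_mul, Real.sq_sqrt hdet.le]
    exact le_of_pow_le_pow_left₀ (by norm_num) (Real.exp_pos _).le this
  refine hsq.trans ?_
  have ⟨h5, h6⟩ := abs_le.1 htM
  have h7 : |u| ≤ 7/9 * s := by
    rw [abs_le]; constructor <;> nlinarith
  have h8 := Real.abs_exp_sub_one_sub_id_le (x := u) (by linarith)
  have h9 := (abs_le.1 h8).2
  have h10 : u ^ 2 ≤ (7/9 * s)^2 := by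
    rw [← sq_abs u]; exact pow_le_pow_left₀ (abs_nonneg _) h7 2
  nlinarith

/-! ### smallest eigenvalue -/

lemma eucl_sq (x : Fin d → ℝ) : euclNorm x ^ 2 = x ⬝ᵥ x := by
  rw [euclNorm, Real.sq_sqrt (by positivity)]; simp [dotProduct, sq]

lemma eucl_nonneg (x : Fin d → ℝ) : 0 ≤ euclNorm x := Real.sqrt_nonneg _

lemma dot_le_eucl (x y : Fin d → ℝ) : x ⬝ᵥ y ≤ euclNorm x * euclNorm y := by
  refine (le_abs_self _).trans ?_
  apply abs_le_of_sq_le_sq _ (mul_nonneg (eucl_nonneg _) (eucl_nonneg _))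
  rw [mul_pow, euclNorm, euclNorm, Real.sq_sqrt (by positivity), Real.sq_sqrt (by positivity)]
  exact Finset.sum_mul_sq_le_sq_mul_sq _ _ _

lemma eucl_mulVec_le (M : Matrix (Fin d) (Fin d) ℝ) (x : Fin d → ℝ) :
    euclNorm (M *ᵥ x) ≤ hsNorm M * euclNorm x := by
  refine le_of_pow_le_pow_left₀ two_ne_zero (mul_nonneg (hs_nonneg _) (eucl_nonneg _)) ?_
  rw [mul_pow, hs_sq, euclNorm, euclNorm, Real.sq_sqrt (by positivity), Real.sq_sqrt (by positivity),
    Finset.sum_mul]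
  apply Finset.sum_le_sum
  intro i _
  exact Finset.sum_mul_sq_le_sq_mul_sq Finset.univ (M i) x

lemma eucl_smul (c : ℝ) (x : Fin d → ℝ) : euclNorm (c • x) = |c| * euclNorm x := by
  rw [euclNorm, euclNorm, ← Real.sqrt_sq_eq_abs, ← Real.sqrt_mul (sq_nonneg c)]
  congr 1
  simp [Finset.mul_sum, mul_pow]

lemma eucl_eq_zero {x : Fin d → ℝ} (h : euclNorm x = 0) : x = 0 := by
  have := eucl_sq x
  rw [h] at this
  simpa using this.symm

lemma quad_lower {K : Matrix (Fin d) (Fin d) ℝ} (hK : K.PosDef) :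
    ∃ c > 0, ∀ x : Fin d → ℝ, c * euclNorm x ^ 2 ≤ x ⬝ᵥ K *ᵥ x := by
  obtain ⟨R, hR, hRR, hRd⟩ := exists_sqrt hK
  set h := hsNorm R⁻¹ + 1
  have hh : 0 < h := by have := hs_nonneg R⁻¹; positivity
  refine ⟨(h^2)⁻¹, by positivity, fun x => ?_⟩
  have h1 : x ⬝ᵥ K *ᵥ x = euclNorm (R *ᵥ x) ^ 2 := by
    rw [eucl_sq, ← hRR, ← Matrix.mulVec_mulVec, Matrix.dotProduct_mulVec, ← Matrix.mulVec_transpose,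
      hR]
  have h2 : x = R⁻¹ *ᵥ (R *ᵥ x) := by
    rw [Matrix.mulVec_mulVec, Matrix.nonsing_inv_mul _ hRd.isUnit, Matrix.one_mulVec]
  have h3 : euclNorm x ≤ h * euclNorm (R *ᵥ x) := by
    conv_lhs => rw [h2]
    refine (eucl_mulVec_le _ _).trans ?_
    apply mul_le_mul_of_nonneg_right _ (eucl_nonneg _)
    simp [h]
  rw [h1, inv_mul_le_iff₀ (by positivity), ← mul_pow]
  exact pow_le_pow_left₀ (eucl_nonneg _) h3 2

lemma lam_set_nonempty (hd : 1 ≤ d) (M : Matrix (Fin d) (Fin d) ℝ) :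
    M ⟨0, hd⟩ ⟨0, hd⟩ ∈ {r : ℝ | ∃ x : Fin d → ℝ, euclNorm x = 1 ∧ r = x ⬝ᵥ M.mulVec x} := by
  refine ⟨Pi.single ⟨0, hd⟩ 1, ?_, ?_⟩
  · simp [euclNorm, Pi.single_apply]
  · simp

lemma lam_pos (hd : 1 ≤ d) {K : Matrix (Fin d) (Fin d) ℝ} (hK : K.PosDef) : 0 < lambdaMin K := by
  obtain ⟨c, hc, h⟩ := quad_lower hK
  refine lt_of_lt_of_le hc (le_csInf ⟨_, lam_set_nonempty hd K⟩ ?_)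
  rintro _ ⟨x, hx, rfl⟩
  simpa [hx] using h x

lemma lam_bdd {K : Matrix (Fin d) (Fin d) ℝ} (hK : K.PosDef) :
    BddBelow {r : ℝ | ∃ x : Fin d → ℝ, euclNorm x = 1 ∧ r = x ⬝ᵥ K.mulVec x} := by
  refine ⟨0, ?_⟩
  rintro _ ⟨x, hx, rfl⟩
  simpa using hK.posSemidef.dotProduct_mulVec_nonneg x

lemma lam_le_hs (hd : 1 ≤ d) {K : Matrix (Fin d) (Fin d) ℝ} (hK : K.PosDef) :
    lambdaMin K ≤ hsNorm K :=
  (csInf_le (lam_bdd hK) (lam_set_nonempty hd K)).trans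
    ((le_abs_self _).trans (abs_entry_le_hs _ _ _))

lemma lam_quad {K : Matrix (Fin d) (Fin d) ℝ} (hK : K.PosDef) (x : Fin d → ℝ) :
    lambdaMin K * euclNorm x ^ 2 ≤ x ⬝ᵥ K *ᵥ x := by
  by_cases h0 : euclNorm x = 0
  · rw [eucl_eq_zero h0]; simp [euclNorm]
  have hp : 0 < euclNorm x := lt_of_le_of_ne (eucl_nonneg _) (Ne.symm h0)
  have := csInf_le (lam_bdd hK) ⟨(euclNorm x)⁻¹ • x, by
    rw [eucl_smul, abs_of_pos (inv_pos.2 hp), inv_mul_cancel₀ h0], rfl⟩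
  change lambdaMin K ≤ _ at this
  rw [Matrix.mulVec_smul, smul_dotProduct, dotProduct_smul, smul_eq_mul, smul_eq_mul] at this
  calc _ ≤ ((euclNorm x)⁻¹ * ((euclNorm x)⁻¹ * (x ⬝ᵥ K *ᵥ x))) * euclNorm x ^ 2 := by gcongr
    _ = _ := by field_simp

lemma eucl_inv_mulVec_le (hd : 1 ≤ d) {K : Matrix (Fin d) (Fin d) ℝ} (hK : K.PosDef)
    (v : Fin d → ℝ) : lambdaMin K * euclNorm (K⁻¹ *ᵥ v) ≤ euclNorm v := by
  have hl := lam_pos hd hK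
  have h1 := lam_quad hK (K⁻¹ *ᵥ v)
  rw [Matrix.mulVec_mulVec, Matrix.mul_nonsing_inv _ hK.det_pos.ne'.isUnit, Matrix.one_mulVec] at h1
  have h2 := h1.trans (dot_le_eucl _ _)
  by_cases h0 : euclNorm (K⁻¹ *ᵥ v) = 0
  · rw [h0, mul_zero]; exact eucl_nonneg _
  have hp : 0 < euclNorm (K⁻¹ *ᵥ v) := lt_of_le_of_ne (eucl_nonneg _) (Ne.symm h0)
  by_contra hlt
  push Not at hlt
  nlinarith

lemma hs_inv_mul_le (hd : 1 ≤ d) {K : Matrix (Fin d) (Fin d) ℝ} (hK : K.PosDef)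
    (D : Matrix (Fin d) (Fin d) ℝ) : hsNorm (K⁻¹ * D) ≤ hsNorm D / lambdaMin K := by
  have hl := lam_pos hd hK
  rw [le_div_iff₀ hl]
  refine le_of_pow_le_pow_left₀ two_ne_zero (hs_nonneg _) ?_
  rw [mul_pow, ← hs_transpose D, ← hs_transpose, hs_sq, hs_sq, Finset.sum_mul]
  apply Finset.sum_le_sum
  intro j _
  have := pow_le_pow_left₀ (mul_nonneg hl.le (eucl_nonneg _)) (eucl_inv_mulVec_le hd hK (Dᵀ j)) 2
  rw [mul_pow, euclNorm, euclNorm, Real.sq_sqrt (by positivity), Real.sq_sqrt (by positivity)] at this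
  rw [mul_comm]
  convert! this using 2

lemma quad_upper (D : Matrix (Fin d) (Fin d) ℝ) (x : Fin d → ℝ) :
    x ⬝ᵥ D *ᵥ x ≤ hsNorm D * euclNorm x ^ 2 := by
  refine (dot_le_eucl _ _).trans ?_
  have := mul_le_mul_of_nonneg_left (eucl_mulVec_le D x) (eucl_nonneg x)
  nlinarith

lemma inv_quad_lower (K A : Matrix (Fin d) (Fin d) ℝ) (hK : K.PosDef) (hA : A.PosDef)
    (h : hsNorm (A - K) ≤ lambdaMin K / 2) (x : Fin d → ℝ) :
    (2/3) * (x ⬝ᵥ K⁻¹ *ᵥ x) ≤ x ⬝ᵥ A⁻¹ *ᵥ x := by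
  set y := K⁻¹ *ᵥ x with hy
  have hKy : K *ᵥ y = x := by
    rw [hy, Matrix.mulVec_mulVec, Matrix.mul_nonsing_inv _ hK.det_pos.ne'.isUnit, Matrix.one_mulVec]
  have hxy : x ⬝ᵥ y = y ⬝ᵥ K *ᵥ y := by rw [hKy, dotProduct_comm]
  have h1 : y ⬝ᵥ A *ᵥ y ≤ (3/2) * (y ⬝ᵥ K *ᵥ y) := by
    have e : A = K + (A - K) := by abel
    have h2 := quad_upper (A - K) y
    have h3 := lam_quad hK y
    have h4 : y ⬝ᵥ A *ᵥ y = y ⬝ᵥ K *ᵥ y + y ⬝ᵥ (A - K) *ᵥ y := by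
      conv_lhs => rw [e]
      rw [Matrix.add_mulVec, dotProduct_add]
    have h5 := mul_le_mul_of_nonneg_right h (sq_nonneg (euclNorm y))
    linarith
  have h2 := hA.inv.posSemidef.dotProduct_mulVec_nonneg (x - (2/3 : ℝ) • (A *ᵥ y))
  have hAT : Aᵀ = A := by
    have := hA.isHermitian
    rwa [Matrix.IsHermitian, Matrix.conjTranspose_eq_transpose_of_trivial] at this
  have hAA : A⁻¹ *ᵥ (A *ᵥ y) = y := by
    rw [Matrix.mulVec_mulVec, Matrix.nonsing_inv_mul _ hA.det_pos.ne'.isUnit, Matrix.one_mulVec]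
  have h3 : (A *ᵥ y) ⬝ᵥ (A⁻¹ *ᵥ x) = x ⬝ᵥ y := by
    rw [← Matrix.vecMul_transpose, ← Matrix.dotProduct_mulVec, hAT, Matrix.mulVec_mulVec,
      Matrix.mul_nonsing_inv _ hA.det_pos.ne'.isUnit, Matrix.one_mulVec, dotProduct_comm]
  simp only [star_trivial, Matrix.mulVec_sub, Matrix.mulVec_smul, hAA, sub_dotProduct,
    dotProduct_sub, smul_dotProduct, dotProduct_smul, smul_eq_mul, h3] at h2
  have h4 : (A *ᵥ y) ⬝ᵥ y = y ⬝ᵥ A *ᵥ y := dotProduct_comm _ _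
  rw [h4] at h2
  linarith

lemma posDef_comb (K A B : Matrix (Fin d) (Fin d) ℝ) (hK : K.PosDef) (hA : A.PosDef)
    (hB : B.PosDef) (h : hsNorm (A - K) ≤ lambdaMin K / 2) (h' : hsNorm (B - K) ≤ lambdaMin K / 2) :
    (A⁻¹ + B⁻¹ - K⁻¹).PosDef := by
  apply Matrix.PosDef.of_dotProduct_mulVec_pos
  · exact (hA.inv.isHermitian.add hB.inv.isHermitian).sub hK.inv.isHermitian
  · intro x hx
    have h1 := inv_quad_lower K A hK hA h x
    have h2 := inv_quad_lower K B hK hB h' x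
    have h3 := hK.inv.dotProduct_mulVec_pos hx
    simp only [star_trivial, Matrix.sub_mulVec, Matrix.add_mulVec, dotProduct_sub, dotProduct_add]
      at h3 ⊢
    linarith

lemma det_comb (K A B : Matrix (Fin d) (Fin d) ℝ) (hK : K.PosDef) (hA : A.PosDef)
    (hB : B.PosDef) :
    A.det * B.det * (A⁻¹ + B⁻¹ - K⁻¹).det =
      K.det * (1 - K⁻¹ * (A - K) * (K⁻¹ * (B - K))).det := by
  have e : A * (A⁻¹ + B⁻¹ - K⁻¹) * B = K * (1 - K⁻¹ * (A - K) * (K⁻¹ * (B - K))) := by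
    have a1 : A * A⁻¹ = 1 := Matrix.mul_nonsing_inv _ hA.det_pos.ne'.isUnit
    have b1 : B⁻¹ * B = 1 := Matrix.nonsing_inv_mul _ hB.det_pos.ne'.isUnit
    have k1 : K * K⁻¹ = 1 := Matrix.mul_nonsing_inv _ hK.det_pos.ne'.isUnit
    have k2 : K⁻¹ * K = 1 := Matrix.nonsing_inv_mul _ hK.det_pos.ne'.isUnit
    have l : A * (A⁻¹ + B⁻¹ - K⁻¹) * B = (A * A⁻¹) * B + A * (B⁻¹ * B) - A * K⁻¹ * B := by
      noncomm_ring
    have r : K * (1 - K⁻¹ * (A - K) * (K⁻¹ * (B - K))) =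
        K - (K * K⁻¹) * (A * K⁻¹ * B - A * (K⁻¹ * K) - (K * K⁻¹) * B + (K * K⁻¹) * K) := by
      noncomm_ring
    rw [l, r, a1, b1, k1, k2]
    noncomm_ring
  have := congrArg Matrix.det e
  rw [Matrix.det_mul, Matrix.det_mul, Matrix.det_mul] at this
  rw [← this]; ring

/-- The value of the integral of `φ_A φ_B / φ_K`. -/
lemma Z_bound (hd : 1 ≤ d) (K A B : Matrix (Fin d) (Fin d) ℝ) (hK : K.PosDef) (hA : A.PosDef)
    (hB : B.PosDef) (h : hsNorm (A - K) ≤ lambdaMin K / 2) (h' : hsNorm (B - K) ≤ lambdaMin K / 2) :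
    (Real.sqrt (A.det * B.det * (A⁻¹ + B⁻¹ - K⁻¹).det / K.det))⁻¹ ≤
      1 + (1/2) * (K⁻¹ * (A - K) * (K⁻¹ * (B - K))).trace
        + 2 * (hsNorm (A - K) ^ 2 / lambdaMin K ^ 2) * (hsNorm (B - K) ^ 2 / lambdaMin K ^ 2) := by
  have hl := lam_pos hd hK
  have hp := (posDef_comb K A B hK hA hB h h').det_pos
  have e := det_comb K A B hK hA hB
  have hk := hK.det_pos
  have ha := hA.det_pos
  have hb := hB.det_pos
  have e2 : A.det * B.det * (A⁻¹ + B⁻¹ - K⁻¹).det / K.det =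
      (1 - K⁻¹ * (A - K) * (K⁻¹ * (B - K))).det := by
    rw [e]; field_simp
  rw [e2]
  have hpos : 0 < (1 - K⁻¹ * (A - K) * (K⁻¹ * (B - K))).det := by rw [← e2]; positivity
  have h1 := hs_inv_mul_le hd hK (A - K)
  have h2 := hs_inv_mul_le hd hK (B - K)
  have hm : hsNorm (K⁻¹ * (A - K)) * hsNorm (K⁻¹ * (B - K)) ≤
      (hsNorm (A - K) / lambdaMin K) * (hsNorm (B - K) / lambdaMin K) :=
    mul_le_mul h1 h2 (hs_nonneg _) (div_nonneg (hs_nonneg _) hl.le)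
  have h3 : hsNorm (A - K) / lambdaMin K ≤ 1/2 := by rw [div_le_iff₀ hl]; linarith
  have h4 : hsNorm (B - K) / lambdaMin K ≤ 1/2 := by rw [div_le_iff₀ hl]; linarith
  have h3' : 0 ≤ hsNorm (A - K) / lambdaMin K := div_nonneg (hs_nonneg _) hl.le
  have h4' : 0 ≤ hsNorm (B - K) / lambdaMin K := div_nonneg (hs_nonneg _) hl.le
  have := det_one_sub_bound _ ((hsNorm (A - K) / lambdaMin K) * (hsNorm (B - K) / lambdaMin K))
    (mul_nonneg h3' h4') (by nlinarith) ((hs_mul_le _ _).trans hm)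
    ((abs_trace_mul_le _ _).trans hm) hpos
  refine this.trans (le_of_eq ?_)
  ring

end MatrixPart


section GaussPart

variable {d : ℕ}

lemma gauss_pos {A : Matrix (Fin d) (Fin d) ℝ} (hA : A.PosDef) (x : Fin d → ℝ) :
    0 < gaussDensity A x := by
  have := hA.det_pos
  rw [gaussDensity]
  positivity

lemma gauss_continuous (A : Matrix (Fin d) (Fin d) ℝ) : Continuous (gaussDensity A) := by
  unfold gaussDensity
  fun_prop

lemma gauss_comp {A R : Matrix (Fin d) (Fin d) ℝ} (hR : Rᵀ = R) (hRR : R * R = A)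
    (hRd : R.det ≠ 0) (t y : Fin d → ℝ) :
    Complex.exp (Complex.I * ((t ⬝ᵥ (R *ᵥ y) : ℝ) : ℂ)) * (gaussDensity A (R *ᵥ y) : ℂ) =
    ((Real.sqrt ((2 * Real.pi) ^ d * A.det))⁻¹ : ℝ) *
      Complex.exp (-∑ i, (1/2 : ℂ) * (y i : ℂ) ^ 2 + ∑ i, (Complex.I * ((R *ᵥ t) i : ℂ)) * y i) := by
  have h1 : (R *ᵥ y) ⬝ᵥ A⁻¹ *ᵥ (R *ᵥ y) = ∑ i, y i ^ 2 := by
    have hi : R * (A⁻¹ * R) = 1 := by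
      rw [← hRR, Matrix.mul_inv_rev]
      rw [Matrix.mul_assoc, Matrix.nonsing_inv_mul _ hRd.isUnit, mul_one,
        Matrix.mul_nonsing_inv _ hRd.isUnit]
    have hq : (R *ᵥ y) ⬝ᵥ A⁻¹ *ᵥ (R *ᵥ y) = y ⬝ᵥ (R * (A⁻¹ * R)) *ᵥ y := by
      rw [← Matrix.mulVec_mulVec, ← Matrix.mulVec_mulVec, Matrix.dotProduct_mulVec y R,
        ← Matrix.mulVec_transpose, hR]
    rw [hq, hi, Matrix.one_mulVec]
    simp [dotProduct, sq]
  have h2 : t ⬝ᵥ (R *ᵥ y) = ∑ i, (R *ᵥ t) i * y i := by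
    rw [Matrix.dotProduct_mulVec, ← Matrix.mulVec_transpose, hR]; rfl
  rw [gaussDensity, h1, h2]
  push_cast
  rw [mul_left_comm, ← Complex.exp_add]
  congr 2
  simp only [Finset.mul_sum, ← Finset.sum_neg_distrib]
  rw [add_comm]
  congr 1
  · apply Finset.sum_congr rfl; intros; ring
  · apply Finset.sum_congr rfl; intros; ring

lemma gauss_sqrt_two_pi : ((Real.pi : ℂ) / (1/2 : ℂ)) ^ (1 / 2 : ℂ) = ((Real.sqrt (2 * Real.pi) : ℝ) : ℂ) := by
  have : ((Real.pi : ℂ) / (1/2 : ℂ)) = ((2 * Real.pi : ℝ) : ℂ) := by push_cast; ring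
  rw [this, Real.sqrt_eq_rpow, Complex.ofReal_cpow (by positivity)]
  norm_num

lemma gauss_cov {E : Type*} [NormedAddCommGroup E] [NormedSpace ℝ E] {R : Matrix (Fin d) (Fin d) ℝ}
    (hRd : R.det ≠ 0) (h : (Fin d → ℝ) → E) (hc : Continuous h) :
    (Integrable h ↔ Integrable (fun y => h (R *ᵥ y))) ∧
    ∫ x, h x = |R.det| • ∫ y, h (R *ᵥ y) := by
  have hm := Real.map_matrix_volume_pi_eq_smul_volume_pi hRd
  have hcont : Continuous (fun y : Fin d → ℝ => R *ᵥ y) := by fun_prop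
  have hm' : Measure.map (fun y : Fin d → ℝ => R *ᵥ y) volume
      = ENNReal.ofReal (abs (R.det)⁻¹) • volume := hm
  have hpos : 0 < |R.det⁻¹| := abs_pos.2 (inv_ne_zero hRd)
  constructor
  · have := integrable_map_measure (μ := (volume : Measure (Fin d → ℝ)))
      (f := fun y : Fin d → ℝ => R *ᵥ y) (g := h)
      hc.aestronglyMeasurable hcont.aemeasurable
    rw [hm', integrable_smul_measure (by simpa using hpos.ne') ENNReal.ofReal_ne_top] at this
    exact this
  · have := integral_map (μ := (volume : Measure (Fin d → ℝ)))
      (φ := fun y : Fin d → ℝ => R *ᵥ y) (f := h) hcont.aemeasurable hc.aestronglyMeasurable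
    rw [← this, hm', integral_smul_measure, ENNReal.toReal_ofReal (abs_nonneg _), smul_smul,
      ← abs_mul, mul_inv_cancel₀ hRd]
    simp

lemma gauss_fourier {A : Matrix (Fin d) (Fin d) ℝ} (hA : A.PosDef) (t : Fin d → ℝ) :
    Integrable (fun x => Complex.exp (Complex.I * ((t ⬝ᵥ x : ℝ) : ℂ)) * (gaussDensity A x : ℂ)) ∧
    ∫ x, Complex.exp (Complex.I * ((t ⬝ᵥ x : ℝ) : ℂ)) * (gaussDensity A x : ℂ) =
      ((Real.exp (-(1/2) * (t ⬝ᵥ A *ᵥ t)) : ℝ) : ℂ) := by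
  obtain ⟨R, hR, hRR, hRd⟩ := exists_sqrt hA
  have hc : Continuous
      (fun x => Complex.exp (Complex.I * ((t ⬝ᵥ x : ℝ) : ℂ)) * (gaussDensity A x : ℂ)) := by
    have := gauss_continuous A
    fun_prop
  obtain ⟨c1, c2⟩ := gauss_cov hRd _ hc
  have hb : ∀ i : Fin d, 0 < ((fun _ => (1/2 : ℂ)) i).re := by intro i; norm_num
  rw [c1, c2]
  simp only [gauss_comp hR hRR hRd]
  constructor
  · exact (GaussianFourier.integrable_cexp_neg_sum_mul_add hb _).const_mul _
  · rw [integral_const_mul, GaussianFourier.integral_cexp_neg_sum_mul_add hb]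
    simp only [gauss_sqrt_two_pi]
    rw [Finset.prod_mul_distrib, ← Complex.exp_sum]
    have e1 : t ⬝ᵥ A *ᵥ t = ∑ i, (R *ᵥ t) i ^ 2 := by
      rw [← hRR, ← Matrix.mulVec_mulVec, Matrix.dotProduct_mulVec, ← Matrix.mulVec_transpose, hR]
      simp [dotProduct, sq]
    have e2 : ∑ i, (Complex.I * (((R *ᵥ t) i : ℝ) : ℂ)) ^ 2 / (4 * (1/2 : ℂ)) =
        ((-(1/2) * (t ⬝ᵥ A *ᵥ t) : ℝ) : ℂ) := by
      rw [e1]; push_cast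
      rw [Finset.mul_sum]
      apply Finset.sum_congr rfl
      intro i _
      rw [mul_pow, Complex.I_sq]; ring
    rw [e2, ← Complex.ofReal_exp]
    simp only [Finset.prod_const, Finset.card_univ, Fintype.card_fin]
    have hdet : Real.sqrt A.det = |R.det| := by
      rw [← hRR, Matrix.det_mul, ← sq, Real.sqrt_sq_eq_abs]
    have e3 : |R.det| * ((Real.sqrt ((2 * Real.pi) ^ d * A.det))⁻¹ * Real.sqrt (2 * Real.pi) ^ d) = 1 := by
      rw [Real.sqrt_mul (by positivity), hdet]
      have : Real.sqrt ((2 * Real.pi) ^ d) = Real.sqrt (2 * Real.pi) ^ d := by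
        rw [Real.sqrt_eq_iff_mul_self_eq (by positivity) (by positivity), ← mul_pow,
          Real.mul_self_sqrt (by positivity)]
      rw [this]
      have h1 : |R.det| ≠ 0 := abs_ne_zero.2 hRd
      have h2 : Real.sqrt (2 * Real.pi) ^ d ≠ 0 := by positivity
      field_simp
    rw [Complex.real_smul]
    norm_cast
    rw [← mul_assoc, ← mul_assoc, mul_assoc |R.det|, e3, one_mul]

lemma gauss_integrable {A : Matrix (Fin d) (Fin d) ℝ} (hA : A.PosDef) :
    Integrable (gaussDensity A) := by
  have := (gauss_fourier hA 0).1
  simp only [zero_dotProduct, Complex.ofReal_zero, mul_zero, Complex.exp_zero, one_mul] at this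
  simpa using this.re

lemma gauss_integral {A : Matrix (Fin d) (Fin d) ℝ} (hA : A.PosDef) :
    ∫ x, gaussDensity A x = 1 := by
  have := (gauss_fourier hA 0).2
  simp only [zero_dotProduct, Complex.ofReal_zero, mul_zero, Complex.exp_zero, one_mul,
    Real.exp_zero, integral_ofReal] at this
  exact_mod_cast this

lemma gauss_lintegral {A : Matrix (Fin d) (Fin d) ℝ} (hA : A.PosDef) :
    ∫⁻ x, ENNReal.ofReal (gaussDensity A x) = 1 := by
  rw [← ofReal_integral_eq_lintegral_ofReal (gauss_integrable hA)
    (Filter.Eventually.of_forall fun x => (gauss_pos hA x).le), gauss_integral hA, ENNReal.ofReal_one]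

lemma gaussLaw_prob {A : Matrix (Fin d) (Fin d) ℝ} (hA : A.PosDef) :
    IsProbabilityMeasure (gaussLaw A) :=
  ⟨by rw [gaussLaw, withDensity_apply _ MeasurableSet.univ, Measure.restrict_univ, gauss_lintegral hA]⟩

/-- Gaussian integral of a positive definite quadratic form. -/
lemma gauss_quad_lintegral {S : Matrix (Fin d) (Fin d) ℝ} (hS : S.PosDef) :
    ∫⁻ x : Fin d → ℝ, ENNReal.ofReal (Real.exp (-(1/2) * (x ⬝ᵥ S *ᵥ x))) =
      ENNReal.ofReal (Real.sqrt ((2 * Real.pi) ^ d / S.det)) := by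
  have h := gauss_lintegral hS.inv
  have hp := hS.det_pos
  have hp' := hS.inv.det_pos
  set c := Real.sqrt ((2 * Real.pi) ^ d * S⁻¹.det) with hc
  have hcp : 0 < c := by positivity
  have e : ∀ x, ENNReal.ofReal (Real.exp (-(1/2) * (x ⬝ᵥ S *ᵥ x))) =
      ENNReal.ofReal c * ENNReal.ofReal (gaussDensity S⁻¹ x) := by
    intro x
    rw [← ENNReal.ofReal_mul hcp.le, gaussDensity, ← hc, Matrix.nonsing_inv_nonsing_inv _ hp.ne'.isUnit,
      mul_inv_cancel_left₀ hcp.ne']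
  simp_rw [e]
  rw [lintegral_const_mul _ (gauss_continuous _).measurable.ennreal_ofReal, h, mul_one, hc,
    Matrix.det_nonsing_inv, Ring.inverse_eq_inv', div_eq_mul_inv]

lemma gauss_eq_multi {A : Matrix (Fin d) (Fin d) ℝ} (hA : A.PosDef) :
    (gaussLaw A).map (MeasurableEquiv.toLp 2 (Fin d → ℝ)) = multivariateGaussian 0 A := by
  have := gaussLaw_prob hA
  have : IsProbabilityMeasure ((gaussLaw A).map (MeasurableEquiv.toLp 2 (Fin d → ℝ))) :=
    Measure.isProbabilityMeasure_map (by fun_prop)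
  apply Measure.ext_of_charFun
  ext t
  rw [charFun_multivariateGaussian hA.posSemidef, charFun_apply, integral_map (by fun_prop)
    (by fun_prop), gaussLaw, integral_withDensity_eq_integral_toReal_smul
    (gauss_continuous A).measurable.ennreal_ofReal (by simp)]
  have := (gauss_fourier hA t).2
  convert! this using 1
  · congr 1
    ext x
    rw [ENNReal.toReal_ofReal (gauss_pos hA x).le, Complex.real_smul, mul_comm]
    congr 2
    rw [mul_comm]
    simp [PiLp.inner_apply, dotProduct]
  · push_cast
    congr 1
    simp
    ring

lemma gauss_moment {A : Matrix (Fin d) (Fin d) ℝ} (hA : A.PosDef) (i j : Fin d) :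
    Integrable (fun x : Fin d → ℝ => x i * x j) (gaussLaw A) ∧
    ∫ x, x i * x j ∂(gaussLaw A) = A i j := by
  have h := gauss_eq_multi hA
  have hm : ∀ i : Fin d, MemLp (fun x : EuclideanSpace ℝ (Fin d) => x i) 2 (multivariateGaussian 0 A) := by
    intro i
    have := (IsGaussian.memLp_two_id (μ := multivariateGaussian 0 A))
    exact (EuclideanSpace.proj (𝕜 := ℝ) i).comp_memLp' this
  have h_itg := (hm i).integrable_mul (hm j)
  have hcov := covariance_eval_multivariateGaussian (μ := 0) hA.posSemidef i j
  have hmean : ∀ i : Fin d, ∫ x, (x : EuclideanSpace ℝ (Fin d)) i ∂(multivariateGaussian 0 A) = 0 := by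
    intro i
    have h1 := (EuclideanSpace.proj (𝕜 := ℝ) i).integral_comp_comm
      (IsGaussian.integrable_id (μ := multivariateGaussian 0 A))
    simpa using h1
  rw [covariance_eq_sub (hm i) (hm j), hmean, hmean, zero_mul, sub_zero] at hcov
  rw [← h] at h_itg hcov
  constructor
  · have := (integrable_map_measure h_itg.1 (by fun_prop)).1 h_itg
    exact this
  · rw [integral_map (by fun_prop) h_itg.1] at hcov
    exact hcov

lemma gauss_quad {A : Matrix (Fin d) (Fin d) ℝ} (hA : A.PosDef) (Q : Matrix (Fin d) (Fin d) ℝ) :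
    Integrable (fun x : Fin d → ℝ => x ⬝ᵥ Q *ᵥ x) (gaussLaw A) ∧
    ∫ x, x ⬝ᵥ Q *ᵥ x ∂(gaussLaw A) = (Q * A).trace := by
  have e : (fun x : Fin d → ℝ => x ⬝ᵥ Q *ᵥ x) = fun x => ∑ i, ∑ j, Q i j * (x i * x j) := by
    ext x
    simp only [dotProduct, mulVec, Finset.mul_sum]
    refine Finset.sum_congr rfl fun i _ => Finset.sum_congr rfl fun j _ => by ring
  have hAT : ∀ i j, A i j = A j i := fun i j => by simpa using (hA.isHermitian.apply i j).symm
  have hI : ∀ i j, Integrable (fun x : Fin d → ℝ => Q i j * (x i * x j)) (gaussLaw A) :=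
    fun i j => (gauss_moment hA i j).1.const_mul _
  have hI2 : ∀ i, Integrable (fun x : Fin d → ℝ => ∑ j, Q i j * (x i * x j)) (gaussLaw A) :=
    fun i => integrable_finsetSum _ fun j _ => hI i j
  rw [e]
  constructor
  · exact integrable_finsetSum _ fun i _ => hI2 i
  · rw [integral_finsetSum (μ := gaussLaw A) Finset.univ
      (f := fun i (x : Fin d → ℝ) => ∑ j, Q i j * (x i * x j)) (fun i _ => hI2 i)]
    simp only [Matrix.trace, Matrix.diag, Matrix.mul_apply]
    refine Finset.sum_congr rfl fun i _ => ?_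
    rw [integral_finsetSum (μ := gaussLaw A) Finset.univ
      (f := fun j (x : Fin d → ℝ) => Q i j * (x i * x j)) (fun j _ => hI i j)]
    refine Finset.sum_congr rfl fun j _ => ?_
    rw [integral_const_mul, (gauss_moment hA i j).2, hAT]

lemma log_gauss {A : Matrix (Fin d) (Fin d) ℝ} (hA : A.PosDef) (x : Fin d → ℝ) :
    Real.log (gaussDensity A x) = -(1/2) * ((d:ℝ) * Real.log (2 * Real.pi) + Real.log A.det)
      - (1/2) * (x ⬝ᵥ A⁻¹ *ᵥ x) := by
  have := hA.det_pos
  rw [gaussDensity, Real.log_mul (by positivity) (Real.exp_pos _).ne', Real.log_exp, Real.log_inv,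
    Real.log_sqrt (by positivity), Real.log_mul (by positivity) this.ne', Real.log_pow]
  ring

/-- relative entropy between Gaussians: integrability and bound -/
lemma gauss_kl {K A : Matrix (Fin d) (Fin d) ℝ} (hK : K.PosDef) (hA : A.PosDef) :
    Integrable (fun x => Real.log (gaussDensity A x) - Real.log (gaussDensity K x)) (gaussLaw A) ∧
    ∫ x, (Real.log (gaussDensity A x) - Real.log (gaussDensity K x)) ∂(gaussLaw A) ≤
      (1/2) * (hsNorm K⁻¹ * hsNorm A + hsNorm K * hsNorm A⁻¹) := by
  have := gaussLaw_prob hA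
  have e : (fun x => Real.log (gaussDensity A x) - Real.log (gaussDensity K x)) =
      fun x => (1/2) * (Real.log K.det - Real.log A.det) +
        ((1/2) * (x ⬝ᵥ K⁻¹ *ᵥ x) - (1/2) * (x ⬝ᵥ A⁻¹ *ᵥ x)) := by
    ext x; rw [log_gauss hA, log_gauss hK]; ring
  have q1 := gauss_quad hA K⁻¹
  have q2 := gauss_quad hA A⁻¹
  rw [e]
  have i1 : Integrable (fun x => (1/2) * (x ⬝ᵥ K⁻¹ *ᵥ x)) (gaussLaw A) := q1.1.const_mul _
  have i2 : Integrable (fun x => (1/2) * (x ⬝ᵥ A⁻¹ *ᵥ x)) (gaussLaw A) := q2.1.const_mul _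
  have i12 : Integrable (fun x => (1/2) * (x ⬝ᵥ K⁻¹ *ᵥ x) - (1/2) * (x ⬝ᵥ A⁻¹ *ᵥ x)) (gaussLaw A) :=
    i1.sub i2
  refine ⟨(integrable_const _).add i12, ?_⟩
  rw [integral_add (integrable_const _) i12,
    integral_sub i1 i2, integral_const_mul, integral_const_mul, integral_const_mul,
    q1.2, q2.2, Matrix.nonsing_inv_mul _ hA.det_pos.ne'.isUnit, Matrix.trace_one]
  have h1 := log_det_mul_inv_le hK hA
  have h2 := (le_abs_self _).trans (abs_trace_mul_le K⁻¹ A)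
  have h3 := (le_abs_self _).trans (abs_trace_mul_le K A⁻¹)
  have h4 : (0:ℝ) ≤ d := by positivity
  simp
  linarith

end GaussPart


section EntPart

variable {Ω X : Type*} [MeasurableSpace Ω] [MeasurableSpace X]

lemma mix_prod (Q : Measure Ω) [IsFiniteMeasure Q] (ν : Measure X) [SigmaFinite ν]
    (f : Ω → X → ℝ) (hf : Measurable (Function.uncurry f)) (hpos : ∀ ω x, 0 < f ω x)
    (h_itg : ∀ ω, Integrable (f ω) ν) (hone : ∀ ω, ∫ x, f ω x ∂ν = 1) :
    Integrable (Function.uncurry f) (Q.prod ν) := by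
  rw [integrable_prod_iff hf.aestronglyMeasurable]
  constructor
  · exact Filter.Eventually.of_forall h_itg
  · have : (fun ω => ∫ x, ‖Function.uncurry f (ω, x)‖ ∂ν) = fun _ => (1:ℝ) := by
      ext ω
      rw [← hone ω]
      congr 1; ext x
      exact Real.norm_of_nonneg (hpos ω x).le
    rw [this]
    exact integrable_const _

lemma mix_facts (Q : Measure Ω) [IsFiniteMeasure Q] (ν : Measure X) [SigmaFinite ν]
    (f : Ω → X → ℝ) (hf : Measurable (Function.uncurry f)) (hpos : ∀ ω x, 0 < f ω x)
    (h_itg : ∀ ω, Integrable (f ω) ν) (hone : ∀ ω, ∫ x, f ω x ∂ν = 1) :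
    (∀ᵐ x ∂ν, Integrable (fun ω => f ω x) Q) ∧
    Integrable (fun x => ∫ ω, f ω x ∂Q) ν ∧ ∫ x, (∫ ω, f ω x ∂Q) ∂ν = Q.real Set.univ ∧
    (0 < Q.real Set.univ → ∀ᵐ x ∂ν, 0 < ∫ ω, f ω x ∂Q) := by
  have h := mix_prod Q ν f hf hpos h_itg hone
  have h1 : ∀ᵐ x ∂ν, Integrable (fun ω => f ω x) Q := h.prod_left_ae
  refine ⟨h1, h.integral_prod_right, ?_, ?_⟩
  · rw [← integral_integral_swap h]
    simp [hone]
  · intro ht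
    filter_upwards [h1] with x hx
    rw [integral_pos_iff_support_of_nonneg (fun ω => (hpos ω x).le) hx]
    have : Function.support (fun ω => f ω x) = Set.univ := by
      ext ω; simp [(hpos ω x).ne']
    rw [this]
    by_contra hc
    have : Q Set.univ = 0 := by simpa using hc
    simp [Measure.real, this] at ht

lemma sq_mix (Q : Measure Ω) [IsFiniteMeasure Q] (ν : Measure X) [SigmaFinite ν]
    (f : Ω → X → ℝ) (hf : Measurable (Function.uncurry f)) (hpos : ∀ ω x, 0 < f ω x)
    (φ : X → ℝ) (hφ : Measurable φ) (hφp : ∀ x, 0 < φ x)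
    (Z : Ω → Ω → ℝ) (hZi : Integrable (Function.uncurry Z) (Q.prod Q))
    (hZ : ∀ᵐ z ∂(Q.prod Q), Integrable (fun x => f z.1 x * f z.2 x / φ x) ν ∧
      ∫ x, f z.1 x * f z.2 x / φ x ∂ν ≤ Z z.1 z.2) :
    Integrable (fun x => (∫ ω, f ω x ∂Q) ^ 2 / φ x) ν ∧
    ∫ x, (∫ ω, f ω x ∂Q) ^ 2 / φ x ∂ν ≤ ∫ z, Z z.1 z.2 ∂(Q.prod Q) := by
  set g : (Ω × Ω) → X → ℝ := fun z x => f z.1 x * f z.2 x / φ x with hg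
  have hgm : Measurable (Function.uncurry g) := by
    have e1 : Measurable (fun w : (Ω × Ω) × X => f w.1.1 w.2) :=
      hf.comp ((measurable_fst.comp measurable_fst).prodMk measurable_snd)
    have e2 : Measurable (fun w : (Ω × Ω) × X => f w.1.2 w.2) :=
      hf.comp ((measurable_snd.comp measurable_fst).prodMk measurable_snd)
    exact (e1.mul e2).div (hφ.comp measurable_snd)
  have hgp : ∀ z x, 0 < g z x := fun z x => div_pos (mul_pos (hpos _ _) (hpos _ _)) (hφp _)
  have hnorm : (fun z => ∫ x, ‖Function.uncurry g (z, x)‖ ∂ν) = fun z => ∫ x, g z x ∂ν := by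
    ext z; congr 1; ext x; exact Real.norm_of_nonneg (hgp z x).le
  have hgI : Integrable (fun z => ∫ x, g z x ∂ν) (Q.prod Q) := by
    refine Integrable.mono' hZi ?_ ?_
    · exact (hgm.stronglyMeasurable.integral_prod_right).aestronglyMeasurable
    · filter_upwards [hZ] with z hz
      rw [Real.norm_of_nonneg (integral_nonneg fun x => (hgp z x).le)]
      exact hz.2
  have hI : Integrable (Function.uncurry g) ((Q.prod Q).prod ν) := by
    rw [integrable_prod_iff hgm.aestronglyMeasurable, hnorm]
    exact ⟨hZ.mono fun z hz => hz.1, hgI⟩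
  have e : ∀ x, ∫ z, g z x ∂(Q.prod Q) = (∫ ω, f ω x ∂Q) ^ 2 / φ x := by
    intro x
    simp only [hg]
    rw [integral_div, integral_prod_mul (fun ω => f ω x) (fun ω => f ω x), sq]
  have h2 : Integrable (fun x => ∫ z, g z x ∂(Q.prod Q)) ν := hI.integral_prod_right
  have h3 : ∫ z, ∫ x, g z x ∂ν ∂(Q.prod Q) = ∫ x, ∫ z, g z x ∂(Q.prod Q) ∂ν :=
    integral_integral_swap hI
  simp only [e] at h2 h3
  refine ⟨h2, ?_⟩
  rw [← h3]
  exact integral_mono_ae hgI hZi (hZ.mono fun z hz => hz.2)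

lemma ent_E (Q : Measure Ω) [IsFiniteMeasure Q] (ν : Measure X) [SigmaFinite ν]
    (f : Ω → X → ℝ) (hf : Measurable (Function.uncurry f)) (hpos : ∀ ω x, 0 < f ω x)
    (h_itg : ∀ ω, Integrable (f ω) ν) (hone : ∀ ω, ∫ x, f ω x ∂ν = 1)
    (φ : X → ℝ) (hφ : Measurable φ) (hφp : ∀ x, 0 < φ x)
    (Z : Ω → Ω → ℝ) (hZi : Integrable (Function.uncurry Z) (Q.prod Q))
    (hZ : ∀ᵐ z ∂(Q.prod Q), Integrable (fun x => f z.1 x * f z.2 x / φ x) ν ∧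
      ∫ x, f z.1 x * f z.2 x / φ x ∂ν ≤ Z z.1 z.2)
    (p : X → ℝ) (hp : Integrable p ν) (hp1 : ∫ x, p x ∂ν = 1) (hpp : ∀ᵐ x ∂ν, 0 < p x)
    (hh : Integrable (fun x => (Real.log (p x) - Real.log (φ x)) * ∫ ω, f ω x ∂Q) ν)
    (t : ℝ) (ht : t = Q.real Set.univ) (ht0 : 0 < t) :
    ∫ x, (Real.log (p x) - Real.log (φ x)) * (∫ ω, f ω x ∂Q) ∂ν ≤
      (1 / t) * (∫ z, Z z.1 z.2 ∂(Q.prod Q)) - t := by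
  obtain ⟨-, m2, m3, m4⟩ := mix_facts Q ν f hf hpos h_itg hone
  obtain ⟨s1, s2⟩ := sq_mix Q ν f hf hpos φ hφ hφp Z hZi hZ
  rw [← ht] at m3 m4
  set a : X → ℝ := fun x => ∫ ω, f ω x ∂Q with ha
  have i1 : Integrable (fun x => (1 / t) * (a x ^ 2 / φ x)) ν := s1.const_mul _
  have i2 : Integrable (fun x => t * p x) ν := hp.const_mul _
  have i3 : Integrable (fun x => 2 * a x) ν := m2.const_mul _
  have i12 : Integrable (fun x => (1 / t) * (a x ^ 2 / φ x) + t * p x) ν := i1.add i2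
  have i4 : Integrable (fun x => (1 / t) * (a x ^ 2 / φ x) + t * p x - 2 * a x) ν := i12.sub i3
  have key : ∫ x, (Real.log (p x) - Real.log (φ x)) * a x ∂ν ≤
      ∫ x, ((1 / t) * (a x ^ 2 / φ x) + t * p x - 2 * a x) ∂ν := by
    refine integral_mono_ae hh i4 ?_
    filter_upwards [hpp, m4 ht0] with x hx hax
    have hax : 0 < a x := hax
    have hφx := hφp x
    show (Real.log (p x) - Real.log (φ x)) * a x ≤ (1 / t) * (a x ^ 2 / φ x) + t * p x - 2 * a x
    have l1 := Real.log_le_sub_one_of_pos (div_pos hax (mul_pos ht0 hφx))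
    have l2 := Real.log_le_sub_one_of_pos (div_pos (mul_pos ht0 hx) hax)
    rw [Real.log_div hax.ne' (by positivity), Real.log_mul ht0.ne' hφx.ne'] at l1
    rw [Real.log_div (by positivity) hax.ne', Real.log_mul ht0.ne' hx.ne'] at l2
    have : Real.log (p x) - Real.log (φ x) ≤ a x / (t * φ x) - 1 + (t * p x / a x - 1) := by linarith
    calc _ ≤ (a x / (t * φ x) - 1 + (t * p x / a x - 1)) * a x := by gcongr
      _ = _ := by field_simp; ring
  rw [integral_sub i12 i3, integral_add i1 i2, integral_const_mul, integral_const_mul,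
    integral_const_mul, hp1, m3] at key
  have : (1 / t) * ∫ x, a x ^ 2 / φ x ∂ν ≤ (1 / t) * ∫ z, Z z.1 z.2 ∂(Q.prod Q) := by
    gcongr
  linarith

lemma ent_bound (P : Measure Ω) [IsProbabilityMeasure P] (ν : Measure X) [SigmaFinite ν]
    (f : Ω → X → ℝ) (hf : Measurable (Function.uncurry f)) (hpos : ∀ ω x, 0 < f ω x)
    (h_itg : ∀ ω, Integrable (f ω) ν) (hone : ∀ ω, ∫ x, f ω x ∂ν = 1)
    (φ : X → ℝ) (hφ : Measurable φ) (hφp : ∀ x, 0 < φ x)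
    (E : Set Ω) (hE : MeasurableSet E)
    (Z : Ω → Ω → ℝ) (hZi : Integrable (Function.uncurry Z) ((P.restrict E).prod (P.restrict E)))
    (hZ : ∀ ω ∈ E, ∀ ω' ∈ E, Integrable (fun x => f ω x * f ω' x / φ x) ν ∧
      ∫ x, f ω x * f ω' x / φ x ∂ν ≤ Z ω ω')
    (k : Ω → ℝ) (hk : Integrable k P)
    (hkl : ∀ ω, Integrable (fun x => (Real.log (f ω x) - Real.log (φ x)) * f ω x) ν ∧
      ∫ x, (Real.log (f ω x) - Real.log (φ x)) * f ω x ∂ν ≤ k ω)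
    (hh : Integrable (fun x => (Real.log (∫ ω, f ω x ∂P) - Real.log (φ x)) * ∫ ω, f ω x ∂P) ν) :
    ∫ x, (Real.log (∫ ω, f ω x ∂P) - Real.log (φ x)) * (∫ ω, f ω x ∂P) ∂ν ≤
      (1 / P.real E) * ((∫ z, Z z.1 z.2 ∂((P.restrict E).prod (P.restrict E))) - P.real E ^ 2)
      + ∫ ω in Eᶜ, k ω ∂P := by
  obtain ⟨m1, m2, m3, m4⟩ := mix_facts P ν f hf hpos h_itg hone
  have mI := mix_prod P ν f hf hpos h_itg hone
  simp only [probReal_univ] at m3 m4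
  have m4 := m4 one_pos
  set p : X → ℝ := fun x => ∫ ω, f ω x ∂P with hp
  have hpm : Measurable p := by
    have : StronglyMeasurable fun x => ∫ ω, f ω x ∂P :=
      StronglyMeasurable.integral_prod_left (f := f) hf.stronglyMeasurable
    exact this.measurable
  set h : X → ℝ := fun x => Real.log (p x) - Real.log (φ x) with hhd
  have hhm : Measurable h := (hpm.log).sub hφ.log
  -- joint integrability
  have hJm : Measurable (Function.uncurry fun ω x => h x * f ω x) :=
    (hhm.comp measurable_snd).mul hf
  have hJ : Integrable (Function.uncurry fun ω x => h x * f ω x) (P.prod ν) := by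
    rw [integrable_prod_iff' hJm.aestronglyMeasurable]
    constructor
    · filter_upwards [m1] with x hx
      exact hx.const_mul (h x)
    · refine hh.norm.congr ?_
      refine Filter.Eventually.of_forall fun x => ?_
      show ‖h x * p x‖ = ∫ ω, ‖h x * f ω x‖ ∂P
      simp only [norm_mul]
      rw [integral_const_mul, hp]
      congr 1
      rw [Real.norm_of_nonneg (integral_nonneg fun ω => (hpos ω x).le)]
      congr 1; ext ω; exact (Real.norm_of_nonneg (hpos ω x).le).symm
  have e1 : ∫ x, h x * p x ∂ν = ∫ ω, ∫ x, h x * f ω x ∂ν ∂P := by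
    rw [integral_integral_swap hJ]
    congr 1; ext x; rw [integral_const_mul]
  have hJ1 : Integrable (fun ω => ∫ x, h x * f ω x ∂ν) P := hJ.integral_prod_left
  have e2 := integral_add_compl hE hJ1
  rw [e1, ← e2]
  refine add_le_add ?_ ?_
  · -- E part
    rcases (measureReal_nonneg (μ := P) (s := E)).eq_or_lt with h0 | h0
    · rw [← h0]
      have : P.restrict E = 0 := by
        rw [Measure.restrict_eq_zero]
        simpa [Measure.real, ENNReal.toReal_eq_zero_iff] using h0.symm
      simp [this]
    · have hle : (P.restrict E).prod ν ≤ P.prod ν := by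
        have := Measure.prod_restrict (μ := P) (ν := ν) E Set.univ
        rw [Measure.restrict_univ] at this
        rw [this]; exact Measure.restrict_le_self
      have hJE := hJ.mono_measure hle
      have e3 : ∫ ω in E, ∫ x, h x * f ω x ∂ν ∂P = ∫ x, h x * ∫ ω in E, f ω x ∂P ∂ν := by
        rw [integral_integral_swap hJE]
        congr 1; ext x; rw [integral_const_mul]
      have hi : Integrable (fun x => h x * ∫ ω in E, f ω x ∂P) ν := by
        have := hJE.integral_prod_right
        refine this.congr (Filter.Eventually.of_forall fun x => ?_)
        exact integral_const_mul (h x) (fun ω => f ω x)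
      rw [e3]
      have hZ' : ∀ᵐ z ∂((P.restrict E).prod (P.restrict E)),
          Integrable (fun x => f z.1 x * f z.2 x / φ x) ν ∧
          ∫ x, f z.1 x * f z.2 x / φ x ∂ν ≤ Z z.1 z.2 := by
        rw [Measure.prod_restrict]
        rw [ae_restrict_iff' (hE.prod hE)]
        exact Filter.Eventually.of_forall fun z hz => hZ _ hz.1 _ hz.2
      have := ent_E (P.restrict E) ν f hf hpos h_itg hone φ hφ hφp Z hZi hZ' p m2 m3 m4 hi
        (P.real E) (by simp) h0
      refine this.trans (le_of_eq ?_)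
      field_simp
  · -- complement part
    refine setIntegral_mono_ae hJ1.integrableOn hk.integrableOn ?_
    have := hJ.prod_right_ae
    filter_upwards [this] with ω hω
    have hω : Integrable (fun x => h x * f ω x) ν := hω
    obtain ⟨k1, k2⟩ := hkl ω
    have i1 : Integrable (fun x => (Real.log (f ω x) - Real.log (φ x)) * f ω x + p x) ν := k1.add m2
    have i2 : Integrable (fun x => (Real.log (f ω x) - Real.log (φ x)) * f ω x + p x - f ω x) ν :=
      i1.sub (h_itg ω)
    have : ∫ x, h x * f ω x ∂ν ≤
        ∫ x, ((Real.log (f ω x) - Real.log (φ x)) * f ω x + p x - f ω x) ∂ν := by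
      refine integral_mono_ae hω i2 ?_
      filter_upwards [m4] with x hx
      have hx : 0 < p x := hx
      have hfx := hpos ω x
      have l2 := Real.log_le_sub_one_of_pos (div_pos hx hfx)
      rw [Real.log_div hx.ne' hfx.ne'] at l2
      show (Real.log (p x) - Real.log (φ x)) * f ω x ≤ _
      have : (Real.log (p x) - Real.log (f ω x)) * f ω x ≤ (p x / f ω x - 1) * f ω x := by gcongr
      have e : (p x / f ω x - 1) * f ω x = p x - f ω x := by field_simp
      rw [e] at this
      show _ ≤ (Real.log (f ω x) - Real.log (φ x)) * f ω x + p x - f ω x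
      linarith
    rw [integral_sub i1 (h_itg ω), integral_add k1 m2, m3, hone ω] at this
    show _ ≤ k ω
    linarith

end EntPart


section LawPart

variable {d : ℕ} {Ω : Type*} [MeasurableSpace Ω]

lemma meas_det {A : Ω → Matrix (Fin d) (Fin d) ℝ} (hA : ∀ i j, Measurable fun ω => A ω i j) :
    Measurable fun ω => (A ω).det := by
  simp only [Matrix.det_apply]
  refine Finset.measurable_fun_sum _ fun σ _ => ?_
  refine Measurable.const_smul ?_ _
  exact Finset.measurable_fun_prod _ fun i _ => hA _ _

lemma meas_inv {A : Ω → Matrix (Fin d) (Fin d) ℝ} (hA : ∀ i j, Measurable fun ω => A ω i j)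
    (i j : Fin d) : Measurable fun ω => (A ω)⁻¹ i j := by
  simp only [Matrix.inv_def, Matrix.smul_apply, Ring.inverse_eq_inv', smul_eq_mul]
  refine (meas_det hA).inv.mul ?_
  simp only [Matrix.adjugate_apply]
  refine meas_det fun k l => ?_
  by_cases h : k = j
  · subst h; simp
  · simp only [Matrix.updateRow_ne h]; exact hA k l

lemma meas_hs {A : Ω → Matrix (Fin d) (Fin d) ℝ} (hA : ∀ i j, Measurable fun ω => A ω i j) :
    Measurable fun ω => hsNorm (A ω) := by
  unfold hsNorm
  refine Measurable.sqrt ?_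
  exact Finset.measurable_fun_sum _ fun i _ => Finset.measurable_fun_sum _ fun j _ => (hA i j).pow_const 2

lemma meas_gauss {A : Ω → Matrix (Fin d) (Fin d) ℝ} (hA : ∀ i j, Measurable fun ω => A ω i j) :
    Measurable (Function.uncurry fun ω x => gaussDensity (A ω) x) := by
  have h1 : Measurable fun p : Ω × (Fin d → ℝ) => (A p.1).det := (meas_det hA).comp measurable_fst
  have h2 : ∀ i j, Measurable fun p : Ω × (Fin d → ℝ) => (A p.1)⁻¹ i j :=
    fun i j => (meas_inv hA i j).comp measurable_fst
  have h3 : ∀ i, Measurable fun p : Ω × (Fin d → ℝ) => p.2 i := fun i => by fun_prop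
  unfold Function.uncurry gaussDensity
  simp only [dotProduct, mulVec]
  refine Measurable.mul ?_ ?_
  · exact ((h1.const_mul _).sqrt).inv
  · refine Measurable.exp (Measurable.const_mul ?_ _)
    exact Finset.measurable_fun_sum _ fun i _ => (h3 i).mul
      (Finset.measurable_fun_sum _ fun j _ => (h2 i j).mul (h3 j))

lemma law_mix (P : Measure Ω) [IsProbabilityMeasure P] {A : Ω → Matrix (Fin d) (Fin d) ℝ}
    (hAm : ∀ i j, Measurable fun ω => A ω i j) (hA : ∀ ω, (A ω).PosDef)
    (F : Ω → Fin d → ℝ) (hF : AEMeasurable F P)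
    (hch : ∀ y : Fin d → ℝ, ∫ ω, Complex.exp (Complex.I * ((y ⬝ᵥ F ω : ℝ) : ℂ)) ∂P =
      ∫ ω, ((Real.exp (-(1/2) * (y ⬝ᵥ (A ω) *ᵥ y)) : ℝ) : ℂ) ∂P) :
    Measure.map F P = volume.withDensity
      (fun x => ENNReal.ofReal (∫ ω, gaussDensity (A ω) x ∂P)) := by
  have mg := meas_gauss hAm
  obtain ⟨m1, m2, m3, m4⟩ := mix_facts P volume _ mg (fun ω x => gauss_pos (hA ω) x)
    (fun ω => gauss_integrable (hA ω)) (fun ω => gauss_integral (hA ω))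
  have mI := mix_prod P volume _ mg (fun ω x => gauss_pos (hA ω) x)
    (fun ω => gauss_integrable (hA ω)) (fun ω => gauss_integral (hA ω))
  set p : (Fin d → ℝ) → ℝ := fun x => ∫ ω, gaussDensity (A ω) x ∂P with hp
  have hp0 : ∀ x, 0 ≤ p x := fun x => integral_nonneg fun ω => (gauss_pos (hA ω) x).le
  have hpm : Measurable p := by
    have : StronglyMeasurable fun x => ∫ ω, gaussDensity (A ω) x ∂P :=
      StronglyMeasurable.integral_prod_left (f := fun ω x => gaussDensity (A ω) x) mg.stronglyMeasurable
    exact this.measurable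
  have i1 : IsProbabilityMeasure (Measure.map F P) := Measure.isProbabilityMeasure_map hF
  have i2 : IsProbabilityMeasure (volume.withDensity (fun x => ENNReal.ofReal (p x))) := by
    constructor
    rw [withDensity_apply _ MeasurableSet.univ, Measure.restrict_univ,
      ← ofReal_integral_eq_lintegral_ofReal m2 (Filter.Eventually.of_forall hp0), m3]
    simp
  apply (MeasurableEquiv.toLp 2 (Fin d → ℝ)).map_measurableEquiv_injective
  have : IsProbabilityMeasure ((Measure.map F P).map (MeasurableEquiv.toLp 2 (Fin d → ℝ))) :=
    Measure.isProbabilityMeasure_map (by fun_prop)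
  have : IsProbabilityMeasure ((volume.withDensity (fun x => ENNReal.ofReal (p x))).map
      (MeasurableEquiv.toLp 2 (Fin d → ℝ))) :=
    Measure.isProbabilityMeasure_map (by fun_prop)
  apply Measure.ext_of_charFun
  ext t
  rw [charFun_apply, charFun_apply, integral_map (by fun_prop) (by fun_prop),
    integral_map hF (by fun_prop), integral_map (by fun_prop) (by fun_prop),
    integral_withDensity_eq_integral_toReal_smul hpm.ennreal_ofReal (by simp)]
  have hin : ∀ x : Fin d → ℝ, Complex.exp (((inner ℝ ((MeasurableEquiv.toLp 2 (Fin d → ℝ)) x) t : ℝ) : ℂ) * Complex.I)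
      = Complex.exp (Complex.I * (((t : Fin d → ℝ) ⬝ᵥ x : ℝ) : ℂ)) := by
    intro x
    rw [mul_comm]
    simp [PiLp.inner_apply, dotProduct]
  simp only [hin]
  rw [hch]
  have hJm : Measurable (Function.uncurry fun (ω : Ω) (x : Fin d → ℝ) =>
      Complex.exp (Complex.I * (((t : Fin d → ℝ) ⬝ᵥ x : ℝ) : ℂ)) * (gaussDensity (A ω) x : ℂ)) := by
    refine Measurable.mul ?_ (Complex.measurable_ofReal.comp mg)
    have hc : Continuous fun x : Fin d → ℝ =>
      Complex.exp (Complex.I * (((t : Fin d → ℝ) ⬝ᵥ x : ℝ) : ℂ)) := by fun_prop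
    exact hc.measurable.comp measurable_snd
  have hJ : Integrable (Function.uncurry fun (ω : Ω) (x : Fin d → ℝ) =>
      Complex.exp (Complex.I * (((t : Fin d → ℝ) ⬝ᵥ x : ℝ) : ℂ)) * (gaussDensity (A ω) x : ℂ))
      (P.prod volume) := by
    refine mI.mono hJm.aestronglyMeasurable (Filter.Eventually.of_forall fun z => ?_)
    simp [Function.uncurry, mul_comm Complex.I, Complex.norm_exp_ofReal_mul_I]
  have := integral_integral_swap hJ
  simp only [(gauss_fourier (hA _) _).2] at this
  rw [this]
  congr 1
  ext x
  rw [integral_const_mul, ENNReal.toReal_ofReal (hp0 x), Complex.real_smul, mul_comm, hp]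
  congr 1
  exact integral_ofReal

lemma relEnt_formula {K : Matrix (Fin d) (Fin d) ℝ} (hK : K.PosDef) (p : (Fin d → ℝ) → ℝ)
    (hp : Measurable p) (hp0 : ∀ x, 0 ≤ p x) :
    relEnt (volume.withDensity (fun x => ENNReal.ofReal (p x))) (gaussLaw K) =
      ∫ x, (Real.log (p x) - Real.log (gaussDensity K x)) * p x := by
  have hφ := (gauss_continuous K).measurable
  have hφp := gauss_pos hK
  have i := gaussLaw_prob hK
  have hq : Measurable fun x => p x / gaussDensity K x := hp.div hφ
  have e : volume.withDensity (fun x => ENNReal.ofReal (p x)) =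
      (gaussLaw K).withDensity (fun x => ENNReal.ofReal (p x / gaussDensity K x)) := by
    rw [gaussLaw, ← withDensity_mul _ hφ.ennreal_ofReal hq.ennreal_ofReal]
    congr 1
    ext x
    simp only [Pi.mul_apply]
    rw [← ENNReal.ofReal_mul (hφp x).le, mul_div_cancel₀ _ (hφp x).ne']
  have hr : ((volume.withDensity (fun x => ENNReal.ofReal (p x))).rnDeriv (gaussLaw K))
      =ᵐ[volume.withDensity (fun x => ENNReal.ofReal (p x))]
      fun x => ENNReal.ofReal (p x / gaussDensity K x) := by
    have h1 := Measure.rnDeriv_withDensity (gaussLaw K) hq.ennreal_ofReal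
    have h2 : volume.withDensity (fun x => ENNReal.ofReal (p x)) ≪ gaussLaw K := by
      rw [e]; exact withDensity_absolutelyContinuous _ _
    apply h2.ae_le
    rw [e]
    exact h1
  have h3 : relEnt (volume.withDensity (fun x => ENNReal.ofReal (p x))) (gaussLaw K) =
      ∫ x, Real.log (p x / gaussDensity K x) ∂(volume.withDensity (fun x => ENNReal.ofReal (p x))) := by
    unfold relEnt
    refine integral_congr_ae ?_
    filter_upwards [hr] with x hx
    rw [hx, ENNReal.toReal_ofReal (div_nonneg (hp0 x) (hφp x).le)]
  rw [h3, integral_withDensity_eq_integral_toReal_smul hp.ennreal_ofReal (by simp)]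
  congr 1
  ext x
  rw [ENNReal.toReal_ofReal (hp0 x), smul_eq_mul, mul_comm]
  rcases (hp0 x).eq_or_lt with h | h
  · rw [← h]; simp
  · rw [Real.log_div h.ne' (hφp x).ne']

end LawPart


section GEnt

variable {d : ℕ}

lemma gauss_Z (hd : 1 ≤ d) {K A B : Matrix (Fin d) (Fin d) ℝ} (hK : K.PosDef) (hA : A.PosDef)
    (hB : B.PosDef) (h : hsNorm (A - K) ≤ lambdaMin K / 2) (h' : hsNorm (B - K) ≤ lambdaMin K / 2) :
    Integrable (fun x => gaussDensity A x * gaussDensity B x / gaussDensity K x) ∧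
    ∫ x, gaussDensity A x * gaussDensity B x / gaussDensity K x ≤
      1 + (1/2) * (K⁻¹ * (A - K) * (K⁻¹ * (B - K))).trace
        + 2 * (hsNorm (A - K) ^ 2 / lambdaMin K ^ 2) * (hsNorm (B - K) ^ 2 / lambdaMin K ^ 2) := by
  have hS := posDef_comb K A B hK hA hB h h'
  have hz := Z_bound hd K A B hK hA hB h h'
  set S := A⁻¹ + B⁻¹ - K⁻¹ with hSd
  have hdS := hS.det_pos
  have hdA := hA.det_pos
  have hdB := hB.det_pos
  have hdK := hK.det_pos
  have e : (fun x => gaussDensity A x * gaussDensity B x / gaussDensity K x) =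
      fun x => (Real.sqrt (A.det * B.det * S.det / K.det))⁻¹ * gaussDensity S⁻¹ x := by
    ext x
    have hx : x ⬝ᵥ S *ᵥ x = x ⬝ᵥ A⁻¹ *ᵥ x + x ⬝ᵥ B⁻¹ *ᵥ x - x ⬝ᵥ K⁻¹ *ᵥ x := by
      rw [hSd, Matrix.sub_mulVec, Matrix.add_mulVec, dotProduct_sub, dotProduct_add]
    unfold gaussDensity
    rw [Matrix.nonsing_inv_nonsing_inv _ hdS.ne'.isUnit, hx, Matrix.det_nonsing_inv,
      Ring.inverse_eq_inv']
    have hexp : Real.exp (-(1/2) * (x ⬝ᵥ A⁻¹ *ᵥ x + x ⬝ᵥ B⁻¹ *ᵥ x - x ⬝ᵥ K⁻¹ *ᵥ x)) =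
        Real.exp (-(1/2) * (x ⬝ᵥ A⁻¹ *ᵥ x)) * Real.exp (-(1/2) * (x ⬝ᵥ B⁻¹ *ᵥ x)) /
          Real.exp (-(1/2) * (x ⬝ᵥ K⁻¹ *ᵥ x)) := by
      rw [← Real.exp_add, ← Real.exp_sub]; congr 1; ring
    rw [hexp]
    have hp : (0:ℝ) < (2 * Real.pi) ^ d := by positivity
    set T := (2 * Real.pi) ^ d with hT
    rw [Real.sqrt_mul hp.le, Real.sqrt_mul hp.le, Real.sqrt_mul hp.le, Real.sqrt_mul hp.le,
      Real.sqrt_div (by positivity), Real.sqrt_mul (by positivity), Real.sqrt_mul (by positivity),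
      Real.sqrt_inv]
    have a1 : Real.sqrt A.det ≠ 0 := by positivity
    have a2 : Real.sqrt B.det ≠ 0 := by positivity
    have a3 : Real.sqrt K.det ≠ 0 := by positivity
    have a4 : Real.sqrt S.det ≠ 0 := by positivity
    have a5 : Real.sqrt T ≠ 0 := by positivity
    have a6 := (Real.exp_pos (-(1/2) * (x ⬝ᵥ K⁻¹ *ᵥ x))).ne'
    field_simp
  rw [e]
  refine ⟨(gauss_integrable hS.inv).const_mul _, ?_⟩
  rw [integral_const_mul, gauss_integral hS.inv, mul_one]
  exact hz

variable {Ω : Type*} [MeasurableSpace Ω]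

lemma int_trace (Q : Measure Ω) [IsFiniteMeasure Q] (K : Matrix (Fin d) (Fin d) ℝ)
    (D : Ω → Matrix (Fin d) (Fin d) ℝ) (hD : ∀ i j, Integrable (fun ω => D ω i j) Q) :
    Integrable (fun z : Ω × Ω => (K * D z.1 * (K * D z.2)).trace) (Q.prod Q) ∧
    ∫ z, (K * D z.1 * (K * D z.2)).trace ∂(Q.prod Q) =
      ((K * Matrix.of fun i j => ∫ ω, D ω i j ∂Q) * (K * Matrix.of fun i j => ∫ ω, D ω i j ∂Q)).trace := by
  have hU : ∀ i j, Integrable (fun ω => (K * D ω) i j) Q := by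
    intro i j
    simp only [Matrix.mul_apply]
    exact integrable_finsetSum _ fun l _ => (hD l j).const_mul _
  have hUi : ∀ i j, ∫ ω, (K * D ω) i j ∂Q = (K * Matrix.of fun i j => ∫ ω, D ω i j ∂Q) i j := by
    intro i j
    simp only [Matrix.mul_apply]
    rw [integral_finsetSum (μ := Q) Finset.univ (f := fun l ω => K i l * D ω l j)
      (fun l _ => (hD l j).const_mul _)]
    simp only [integral_const_mul, Matrix.of_apply]
  have e : (fun z : Ω × Ω => (K * D z.1 * (K * D z.2)).trace) =
      fun z => ∑ i, ∑ l, (K * D z.1) i l * (K * D z.2) l i := by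
    ext z
    simp only [Matrix.trace, Matrix.diag]
    refine Finset.sum_congr rfl fun i _ => ?_
    rw [Matrix.mul_apply]
  have hI : ∀ i l, Integrable (fun z : Ω × Ω => (K * D z.1) i l * (K * D z.2) l i) (Q.prod Q) :=
    fun i l => (hU i l).mul_prod (hU l i)
  have hI2 : ∀ i, Integrable (fun z : Ω × Ω => ∑ l, (K * D z.1) i l * (K * D z.2) l i) (Q.prod Q) :=
    fun i => integrable_finsetSum _ fun l _ => hI i l
  rw [e]
  refine ⟨integrable_finsetSum _ fun i _ => hI2 i, ?_⟩
  rw [integral_finsetSum (μ := Q.prod Q) Finset.univ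
    (f := fun i (z : Ω × Ω) => ∑ l, (K * D z.1) i l * (K * D z.2) l i) (fun i _ => hI2 i)]
  simp only [Matrix.trace, Matrix.diag]
  refine Finset.sum_congr rfl fun i _ => ?_
  rw [integral_finsetSum (μ := Q.prod Q) Finset.univ
    (f := fun l (z : Ω × Ω) => (K * D z.1) i l * (K * D z.2) l i) (fun l _ => hI i l)]
  rw [Matrix.mul_apply (M := K * Matrix.of fun i j => ∫ ω, D ω i j ∂Q)]
  refine Finset.sum_congr rfl fun l _ => ?_
  rw [integral_prod_mul (fun ω => (K * D ω) i l) (fun ω => (K * D ω) l i), hUi, hUi]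

lemma gauss_ent (hd : 1 ≤ d) (P : Measure Ω) [IsProbabilityMeasure P]
    {K : Matrix (Fin d) (Fin d) ℝ} (hK : K.PosDef) {A : Ω → Matrix (Fin d) (Fin d) ℝ}
    (hAm : ∀ i j, Measurable fun ω => A ω i j) (hA : ∀ ω, (A ω).PosDef)
    (hA1 : Integrable (fun ω => hsNorm (A ω)) P)
    (hAi : Integrable (fun ω => hsNorm (A ω)⁻¹) P)
    (hD2 : Integrable (fun ω => hsNorm (A ω - K) ^ 2) P)
    (hD : ∀ i j, Integrable (fun ω => (A ω - K) i j) P)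
    (E : Set Ω) (hEd : E = {ω | hsNorm (A ω - K) ≤ lambdaMin K / 2}) (hE : MeasurableSet E)
    (hh : Integrable (fun x => (Real.log (∫ ω, gaussDensity (A ω) x ∂P)
      - Real.log (gaussDensity K x)) * ∫ ω, gaussDensity (A ω) x ∂P)) :
    ∫ x, (Real.log (∫ ω, gaussDensity (A ω) x ∂P)
      - Real.log (gaussDensity K x)) * (∫ ω, gaussDensity (A ω) x ∂P) ≤
    (1 / P.real E) * ((1/2) * hsNorm (K⁻¹ * Matrix.of fun i j => ∫ ω in E, (A ω - K) i j ∂P) ^ 2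
      + 2 * ((∫ ω in E, hsNorm (A ω - K) ^ 2 ∂P) / lambdaMin K ^ 2) ^ 2)
    + ∫ ω in Eᶜ, (1/2) * (hsNorm K⁻¹ * hsNorm (A ω) + hsNorm K * hsNorm (A ω)⁻¹) ∂P := by
  set Q := P.restrict E with hQ
  set Z : Ω → Ω → ℝ := fun ω ω' => 1 + (1/2) * (K⁻¹ * (A ω - K) * (K⁻¹ * (A ω' - K))).trace
        + 2 * (hsNorm (A ω - K) ^ 2 / lambdaMin K ^ 2) * (hsNorm (A ω' - K) ^ 2 / lambdaMin K ^ 2) with hZ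
  obtain ⟨t1, t2⟩ := int_trace Q K⁻¹ (fun ω => A ω - K) (fun i j => (hD i j).integrableOn)
  set Db := Matrix.of fun i j => ∫ ω, (A ω - K) i j ∂Q with hDb
  have hq : Integrable (fun ω => hsNorm (A ω - K) ^ 2 / lambdaMin K ^ 2) Q :=
    (hD2.integrableOn).div_const _
  have hq2 : Integrable (fun ω => 2 * (hsNorm (A ω - K) ^ 2 / lambdaMin K ^ 2)) Q := hq.const_mul 2
  have i3 : Integrable (fun z : Ω × Ω => 2 * (hsNorm (A z.1 - K) ^ 2 / lambdaMin K ^ 2)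
      * (hsNorm (A z.2 - K) ^ 2 / lambdaMin K ^ 2)) (Q.prod Q) := hq2.mul_prod hq
  have i1 : Integrable (fun _ : Ω × Ω => (1:ℝ)) (Q.prod Q) := integrable_const _
  have i2 : Integrable (fun z : Ω × Ω => (1/2) * (K⁻¹ * (A z.1 - K) * (K⁻¹ * (A z.2 - K))).trace)
      (Q.prod Q) := t1.const_mul _
  have i12 : Integrable (fun z : Ω × Ω => 1 + (1/2) * (K⁻¹ * (A z.1 - K) * (K⁻¹ * (A z.2 - K))).trace)
      (Q.prod Q) := i1.add i2
  have hZi : Integrable (Function.uncurry Z) (Q.prod Q) := i12.add i3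
  have hZint : ∫ z, Z z.1 z.2 ∂(Q.prod Q) = P.real E ^ 2 + (1/2) * ((K⁻¹ * Db) * (K⁻¹ * Db)).trace
      + 2 * ((∫ ω, hsNorm (A ω - K) ^ 2 ∂Q) / lambdaMin K ^ 2) ^ 2 := by
    simp only [hZ]
    rw [integral_add i12 i3, integral_add i1 i2, integral_const_mul, t2,
      integral_prod_mul (fun ω => 2 * (hsNorm (A ω - K) ^ 2 / lambdaMin K ^ 2))
        (fun ω => (hsNorm (A ω - K) ^ 2 / lambdaMin K ^ 2)), integral_const_mul, integral_div]
    have : ∫ _ : Ω × Ω, (1:ℝ) ∂(Q.prod Q) = P.real E ^ 2 := by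
      rw [integral_const, ← Set.univ_prod_univ, measureReal_prod_prod]
      simp [hQ, sq]
    rw [this]
    ring
  have hk : Integrable (fun ω => (1/2) * (hsNorm K⁻¹ * hsNorm (A ω) + hsNorm K * hsNorm (A ω)⁻¹)) P :=
    ((hA1.const_mul _).add (hAi.const_mul _)).const_mul _
  have hmain := ent_bound P volume (fun ω x => gaussDensity (A ω) x) (meas_gauss hAm)
    (fun ω x => gauss_pos (hA ω) x) (fun ω => gauss_integrable (hA ω))
    (fun ω => gauss_integral (hA ω)) (gaussDensity K) (gauss_continuous K).measurable (gauss_pos hK)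
    E hE Z hZi
    (by
      intro ω hω ω' hω'
      rw [hEd] at hω hω'
      exact gauss_Z hd hK (hA ω) (hA ω') hω hω')
    _ hk
    (by
      intro ω
      have e : ∀ x, ENNReal.toReal (ENNReal.ofReal (gaussDensity (A ω) x)) = gaussDensity (A ω) x :=
        fun x => ENNReal.toReal_ofReal (gauss_pos (hA ω) x).le
      obtain ⟨k1, k2⟩ := gauss_kl hK (hA ω)
      have hm := (gauss_continuous (A ω)).measurable.ennreal_ofReal
      rw [gaussLaw, integrable_withDensity_iff_integrable_smul' hm (by simp)] at k1
      rw [gaussLaw, integral_withDensity_eq_integral_toReal_smul hm (by simp)] at k2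
      simp only [e, smul_eq_mul] at k1 k2
      simp only [mul_comm _ (gaussDensity (A ω) _)]
      exact ⟨k1, k2⟩) hh
  refine hmain.trans ?_
  gcongr
  rw [hZint]
  have h1 := (le_abs_self _).trans (abs_trace_mul_le (K⁻¹ * Db) (K⁻¹ * Db))
  rw [← sq (hsNorm (K⁻¹ * Db))] at h1
  linarith

end GEnt


section Moments

variable {d : ℕ} {Ω : Type*} [MeasurableSpace Ω]

lemma cs_int (P : Measure Ω) (u v : Ω → ℝ) (hu : ∀ ω, 0 ≤ u ω) (hv : ∀ ω, 0 ≤ v ω)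
    (mu : Measurable u) (mv : Measurable v)
    (iu : Integrable (fun ω => u ω ^ 2) P) (iv : Integrable (fun ω => v ω ^ 2) P) :
    Integrable (fun ω => u ω * v ω) P ∧
    ∫ ω, u ω * v ω ∂P ≤ Real.sqrt (∫ ω, u ω ^ 2 ∂P) * Real.sqrt (∫ ω, v ω ^ 2 ∂P) := by
  have lu : MemLp u 2 P := (memLp_two_iff_integrable_sq mu.aestronglyMeasurable).2 iu
  have lv : MemLp v 2 P := (memLp_two_iff_integrable_sq mv.aestronglyMeasurable).2 iv
  refine ⟨lu.integrable_mul lv, ?_⟩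
  have := integral_mul_le_Lp_mul_Lq_of_nonneg (μ := P) (p := 2) (q := 2)
    (by constructor <;> norm_num)
    (f := u) (g := v) (Filter.Eventually.of_forall hu) (Filter.Eventually.of_forall hv)
    (by simpa using lu) (by simpa using lv)
  simpa [Real.sqrt_eq_rpow] using this

lemma hs_int_le (Q : Measure Ω) (D : Ω → Matrix (Fin d) (Fin d) ℝ)
    (hD : ∀ i j, Integrable (fun ω => D ω i j) Q) (hh : Integrable (fun ω => hsNorm (D ω)) Q) :
    hsNorm (Matrix.of fun i j => ∫ ω, D ω i j ∂Q) ≤ ∫ ω, hsNorm (D ω) ∂Q := by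
  set M : Matrix (Fin d) (Fin d) ℝ := Matrix.of fun i j => ∫ ω, D ω i j ∂Q with hM
  have i1 : ∀ i j, Integrable (fun ω => M i j * D ω i j) Q := fun i j => (hD i j).const_mul _
  have i2 : ∀ i, Integrable (fun ω => ∑ j, M i j * D ω i j) Q :=
    fun i => integrable_finsetSum _ fun j _ => i1 i j
  have i3 : Integrable (fun ω => ∑ i, ∑ j, M i j * D ω i j) Q :=
    integrable_finsetSum _ fun i _ => i2 i
  have e : hsNorm M ^ 2 = ∫ ω, ∑ i, ∑ j, M i j * D ω i j ∂Q := by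
    rw [integral_finsetSum (μ := Q) Finset.univ (f := fun i ω => ∑ j, M i j * D ω i j)
      (fun i _ => i2 i), hs_sq]
    refine Finset.sum_congr rfl fun i _ => ?_
    rw [integral_finsetSum (μ := Q) Finset.univ (f := fun j ω => M i j * D ω i j) (fun j _ => i1 i j)]
    refine Finset.sum_congr rfl fun j _ => ?_
    rw [integral_const_mul, sq]
    rfl
  have h1 : hsNorm M ^ 2 ≤ hsNorm M * ∫ ω, hsNorm (D ω) ∂Q := by
    rw [e, ← integral_const_mul]
    refine integral_mono i3 (hh.const_mul _) fun ω => ?_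
    have := (le_abs_self _).trans (abs_trace_mul_le M (D ω)ᵀ)
    rw [hs_transpose] at this
    refine le_trans (le_of_eq ?_) this
    simp [Matrix.trace, Matrix.mul_apply]
  rcases (hs_nonneg M).eq_or_lt with h | h
  · rw [← h]; exact integral_nonneg fun ω => hs_nonneg _
  · rw [sq] at h1; exact le_of_mul_le_mul_left h1 h

lemma pow_int (P : Measure Ω) [IsFiniteMeasure P] (u : Ω → ℝ) (hu : ∀ ω, 0 ≤ u ω)
    (mu : Measurable u) (n : ℕ) (m : ℕ) (hnm : n ≤ m) (iu : Integrable (fun ω => u ω ^ m) P) :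
    Integrable (fun ω => u ω ^ n) P := by
  have : Integrable (fun ω => 1 + u ω ^ m) P := (integrable_const _).add iu
  refine this.mono' (mu.pow_const n).aestronglyMeasurable (Filter.Eventually.of_forall fun ω => ?_)
  rw [Real.norm_of_nonneg (pow_nonneg (hu ω) n)]
  rcases le_total (u ω) 1 with h | h
  · have := pow_le_one₀ (n := n) (hu ω) h
    have := pow_nonneg (hu ω) m
    linarith
  · have := pow_le_pow_right₀ h hnm
    linarith

lemma sq_int_le (P : Measure Ω) [IsProbabilityMeasure P] (u : Ω → ℝ) (hu : ∀ ω, 0 ≤ u ω)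
    (mu : Measurable u) (iu : Integrable (fun ω => u ω ^ 2) P) :
    (∫ ω, u ω ∂P) ^ 2 ≤ ∫ ω, u ω ^ 2 ∂P := by
  have := (cs_int P u (fun _ => 1) hu (fun _ => zero_le_one) mu measurable_const iu (by simp)).2
  simp only [mul_one, one_pow, integral_const, probReal_univ, smul_eq_mul, Real.sqrt_one] at this
  have h0 : 0 ≤ ∫ ω, u ω ∂P := integral_nonneg hu
  calc _ ≤ (Real.sqrt (∫ ω, u ω ^ 2 ∂P)) ^ 2 := by gcongr
    _ = _ := Real.sq_sqrt (integral_nonneg fun ω => sq_nonneg _)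

lemma compl_term (P : Measure Ω) [IsProbabilityMeasure P] (u : Ω → ℝ) (hu : ∀ ω, 0 ≤ u ω)
    (mu : Measurable u) (iu : Integrable (fun ω => u ω ^ 2) P) (E : Set Ω) (hE : MeasurableSet E) :
    ∫ ω in E, u ω ∂P ≤ Real.sqrt (P.real E) * Real.sqrt (∫ ω, u ω ^ 2 ∂P) := by
  have mi : Measurable (E.indicator (1 : Ω → ℝ)) := measurable_one.indicator hE
  have e2 : (fun ω => E.indicator (1 : Ω → ℝ) ω ^ 2) = E.indicator (1 : Ω → ℝ) := by
    ext ω; by_cases h : ω ∈ E <;> simp [h]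
  have := (cs_int P (E.indicator (1 : Ω → ℝ)) u
    (fun ω => Set.indicator_nonneg (fun _ _ => zero_le_one) ω) hu mi mu
    (by rw [e2]; exact (integrable_const (1:ℝ)).indicator hE) iu).2
  rw [e2, integral_indicator_one hE] at this
  refine le_trans (le_of_eq ?_) this
  rw [← integral_indicator hE]
  congr 1; ext ω; by_cases h : ω ∈ E <;> simp [h]

lemma compl_real (κ k a b q u v s l : ℝ) (hκ : 0 ≤ κ) (hk : 0 ≤ k) (hu : 0 ≤ u) (hv : 0 ≤ v)
    (hq : q ≤ 16 * s / l ^ 4) (ha : a ≤ q * u) (hb : b ≤ q * v) :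
    (1/2) * (κ * a + k * b) ≤ (1 / l ^ 4) * (8 * k * v + 8 * κ * u) * s := by
  have d1 : κ * a ≤ κ * (16 * s / l ^ 4 * u) :=
    mul_le_mul_of_nonneg_left (ha.trans (mul_le_mul_of_nonneg_right hq hu)) hκ
  have d2 : k * b ≤ k * (16 * s / l ^ 4 * v) :=
    mul_le_mul_of_nonneg_left (hb.trans (mul_le_mul_of_nonneg_right hq hv)) hk
  calc _ ≤ (1/2) * (κ * (16 * s / l ^ 4 * u) + k * (16 * s / l ^ 4 * v)) := by linarith
    _ = _ := by ring

lemma main_real1 (t g e κ x y m l s : ℝ) (hl : 0 < l) (hx : 0 ≤ x) (hy0 : 0 ≤ y) (hs : 0 ≤ s)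
    (hm : 0 ≤ m) (hκ : 0 ≤ κ) (hg : 0 ≤ g) (he : 0 ≤ e) (ht : 1/2 ≤ t) (hgx : g ≤ κ * (x + y))
    (hem : e ≤ m) (hy : y ≤ 2 / l * m) (hms : m ^ 2 ≤ s) :
    (1 / t) * ((1/2) * g ^ 2 + 2 * (e / l ^ 2) ^ 2) ≤
      (6/5) * κ ^ 2 * x ^ 2 + (1 / l ^ 4) * (24 * κ ^ 2 * l ^ 2 + 4) * s := by
  have h1 : 1 / t ≤ 2 := by
    rw [div_le_iff₀ (by linarith)]; linarith
  have hy2 : y ^ 2 ≤ 4 / l ^ 2 * s := by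
    calc y ^ 2 ≤ (2 / l * m) ^ 2 := by gcongr
      _ = 4 / l ^ 2 * m ^ 2 := by ring
      _ ≤ _ := by gcongr
  have hxy : (x + y) ^ 2 ≤ (6/5) * x ^ 2 + 6 * y ^ 2 := by nlinarith [sq_nonneg (x - 5 * y)]
  calc _ ≤ 2 * ((1/2) * (κ * (x + y)) ^ 2 + 2 * (m / l ^ 2) ^ 2) := by
        gcongr
    _ = κ ^ 2 * (x + y) ^ 2 + 4 / l ^ 4 * m ^ 2 := by ring
    _ ≤ κ ^ 2 * ((6/5) * x ^ 2 + 6 * (4 / l ^ 2 * s)) + 4 / l ^ 4 * s := by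
        gcongr
        linarith
    _ = _ := by field_simp; ring

lemma main_real2 (κ x l s : ℝ) (hl : 0 < l) (hs : 0 ≤ s) (h2 : 1/2 ≤ 16 * s / l ^ 4) :
    1/8 ≤ (6/5) * κ ^ 2 * x ^ 2 + (1 / l ^ 4) * (24 * κ ^ 2 * l ^ 2 + 4) * s := by
  have hr00 : 0 ≤ (6/5) * κ ^ 2 * x ^ 2 := by positivity
  rw [mul_div_assoc] at h2
  have : (1 / l ^ 4) * (24 * κ ^ 2 * l ^ 2 + 4) * s =
    4 * (s / l ^ 4) + 24 * κ ^ 2 * l ^ 2 * (s / l ^ 4) := by ring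
  rw [this]
  have : 0 ≤ 24 * κ ^ 2 * l ^ 2 * (s / l ^ 4) := by positivity
  linarith

lemma main_real3 (t g e : ℝ) (h0 : 0 < t) (ht : t < 1/2) (hg : 0 ≤ g) (he : 0 ≤ e)
    (hgt : g ≤ t * (1/2)) (het : e ≤ t * (1/4)) :
    (1 / t) * ((1/2) * g ^ 2 + 2 * e ^ 2) ≤ 1/8 := by
  calc _ ≤ (1 / t) * ((1/2) * (t * (1/2)) ^ 2 + 2 * (t * (1 / 4)) ^ 2) := by gcongr
    _ = t / 4 := by field_simp; norm_num
    _ ≤ 1/8 := by linarith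

set_option maxHeartbeats 1000000 in
lemma core_bound (hd : 1 ≤ d) (P : Measure Ω) [IsProbabilityMeasure P]
    {K : Matrix (Fin d) (Fin d) ℝ} (hK : K.PosDef) {A : Ω → Matrix (Fin d) (Fin d) ℝ}
    (hAm : ∀ i j, Measurable fun ω => A ω i j) (hA : ∀ ω, (A ω).PosDef)
    (hA8 : Integrable (fun ω => hsNorm (A ω) ^ 8) P)
    (hAinv : Integrable (fun ω => hsNorm (A ω)⁻¹ ^ 2) P)
    (hh : Integrable (fun x => (Real.log (∫ ω, gaussDensity (A ω) x ∂P)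
      - Real.log (gaussDensity K x)) * ∫ ω, gaussDensity (A ω) x ∂P)) :
    ∫ x, (Real.log (∫ ω, gaussDensity (A ω) x ∂P)
      - Real.log (gaussDensity K x)) * (∫ ω, gaussDensity (A ω) x ∂P) ≤
    (6/5) * hsNorm K⁻¹ ^ 2 * hsNorm ((Matrix.of fun i j => ∫ ω, A ω i j ∂P) - K) ^ 2
    + (1 / lambdaMin K ^ 4) * (8 * hsNorm K * Real.sqrt (∫ ω, hsNorm (A ω)⁻¹ ^ 2 ∂P)
        + 8 * hsNorm K⁻¹ * Real.sqrt (∫ ω, hsNorm (A ω) ^ 2 ∂P)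
        + (24 * hsNorm K⁻¹ ^ 2 * lambdaMin K ^ 2 + 4)) *
        Real.sqrt (∫ ω, hsNorm (A ω - K) ^ 8 ∂P) := by
  have hl := lam_pos hd hK
  have hDm : ∀ i j, Measurable fun ω => (A ω - K) i j := fun i j => (hAm i j).sub_const _
  have mA := meas_hs hAm
  have mAi := meas_hs (meas_inv hAm)
  have mr := meas_hs hDm
  have hA2 := pow_int P _ (fun ω => hs_nonneg _) mA 2 8 (by norm_num) hA8
  have hA1 : Integrable (fun ω => hsNorm (A ω)) P := by
    simpa using pow_int P _ (fun ω => hs_nonneg _) mA 1 8 (by norm_num) hA8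
  have hAi1 : Integrable (fun ω => hsNorm (A ω)⁻¹) P := by
    simpa using pow_int P _ (fun ω => hs_nonneg _) mAi 1 2 (by norm_num) hAinv
  set r : Ω → ℝ := fun ω => hsNorm (A ω - K) with hr
  have hr0 : ∀ ω, 0 ≤ r ω := fun ω => hs_nonneg _
  have hr8 : Integrable (fun ω => r ω ^ 8) P := by
    have : Integrable (fun ω => 2 ^ 7 * (hsNorm (A ω) ^ 8 + hsNorm K ^ 8)) P :=
      (hA8.add (integrable_const _)).const_mul _
    refine this.mono' (mr.pow_const 8).aestronglyMeasurable (Filter.Eventually.of_forall fun ω => ?_)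
    rw [Real.norm_of_nonneg (pow_nonneg (hr0 ω) 8)]
    calc r ω ^ 8 ≤ (hsNorm (A ω) + hsNorm K) ^ 8 :=
          pow_le_pow_left₀ (hr0 ω) (hs_sub_le _ _) 8
      _ ≤ _ := add_pow_le (hs_nonneg _) (hs_nonneg _) 8
  have hr4 := pow_int P r hr0 mr 4 8 (by norm_num) hr8
  have hr2 := pow_int P r hr0 mr 2 8 (by norm_num) hr8
  have hr1 : Integrable r P := by simpa using pow_int P r hr0 mr 1 8 (by norm_num) hr8
  have hD : ∀ i j, Integrable (fun ω => (A ω - K) i j) P := fun i j =>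
    hr1.mono' (hDm i j).aestronglyMeasurable (Filter.Eventually.of_forall fun ω => abs_entry_le_hs _ i j)
  have hAij : ∀ i j, Integrable (fun ω => A ω i j) P := fun i j =>
    hA1.mono' (hAm i j).aestronglyMeasurable (Filter.Eventually.of_forall fun ω => abs_entry_le_hs _ i j)
  set l := lambdaMin K with hldef
  set E : Set Ω := {ω | r ω ≤ l / 2} with hEd
  have hE : MeasurableSet E := measurableSet_le mr measurable_const
  have hmain := gauss_ent hd P hK hAm hA hA1 hAi1 hr2 hD E rfl hE hh
  refine hmain.trans ?_
  set s := Real.sqrt (∫ ω, r ω ^ 8 ∂P) with hs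
  have hs0 : 0 ≤ s := Real.sqrt_nonneg _
  -- Markov
  have hMk : Real.sqrt (P.real Eᶜ) ≤ 16 * s / l ^ 4 := by
    have h1 := mul_meas_ge_le_integral_of_nonneg (μ := P) (f := fun ω => r ω ^ 8)
      (Filter.Eventually.of_forall fun ω => pow_nonneg (hr0 ω) 8) hr8 ((l/2) ^ 8)
    have h2 : P.real Eᶜ ≤ P.real {ω | (l/2) ^ 8 ≤ r ω ^ 8} := by
      refine measureReal_mono fun ω hω => ?_
      have : l / 2 < r ω := not_le.1 hω
      exact pow_le_pow_left₀ (by positivity) this.le 8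
    have h3 : (l/2) ^ 8 * P.real Eᶜ ≤ s ^ 2 := by
      rw [hs, Real.sq_sqrt (integral_nonneg fun ω => pow_nonneg (hr0 ω) 8)]
      exact (mul_le_mul_of_nonneg_left h2 (by positivity)).trans h1
    apply Real.sqrt_le_iff.2 ⟨by positivity, ?_⟩
    rw [div_pow, le_div_iff₀ (by positivity)]
    nlinarith
  -- second moment
  have hm4 : (∫ ω, r ω ^ 2 ∂P) ^ 2 ≤ s := by
    have h1 := sq_int_le P (fun ω => r ω ^ 2) (fun ω => sq_nonneg _) (mr.pow_const 2)
      (by simpa only [← pow_mul] using hr4)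
    have h2 := sq_int_le P (fun ω => r ω ^ 4) (fun ω => pow_nonneg (hr0 ω) 4) (mr.pow_const 4)
      (by simpa only [← pow_mul] using hr8)
    simp only [← pow_mul] at h1 h2
    exact h1.trans (Real.le_sqrt_of_sq_le h2)
  set m := ∫ ω, r ω ^ 2 ∂P with hm
  have hm0 : 0 ≤ m := integral_nonneg fun ω => sq_nonneg _
  set κ := hsNorm K⁻¹ with hκ
  have hκ0 : 0 ≤ κ := hs_nonneg _
  have hk0 : 0 ≤ hsNorm K := hs_nonneg _
  -- complement term
  have hcompl : ∫ ω in Eᶜ, (1/2) * (κ * hsNorm (A ω) + hsNorm K * hsNorm (A ω)⁻¹) ∂P ≤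
      (1 / l ^ 4) * (8 * hsNorm K * Real.sqrt (∫ ω, hsNorm (A ω)⁻¹ ^ 2 ∂P)
        + 8 * κ * Real.sqrt (∫ ω, hsNorm (A ω) ^ 2 ∂P)) * s := by
    have c1 := compl_term P _ (fun ω => hs_nonneg _) mA hA2 Eᶜ hE.compl
    have c2 := compl_term P _ (fun ω => hs_nonneg _) mAi hAinv Eᶜ hE.compl
    have j1 : Integrable (fun ω => κ * hsNorm (A ω)) (P.restrict Eᶜ) := (hA1.const_mul _).integrableOn
    have j2 : Integrable (fun ω => hsNorm K * hsNorm (A ω)⁻¹) (P.restrict Eᶜ) :=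
      (hAi1.const_mul _).integrableOn
    rw [integral_const_mul, integral_add j1 j2, integral_const_mul, integral_const_mul]
    exact compl_real _ _ _ _ _ _ _ _ _ hκ0 hk0 (Real.sqrt_nonneg _) (Real.sqrt_nonneg _) hMk c1 c2
  -- main term
  set x := hsNorm ((Matrix.of fun i j => ∫ ω, A ω i j ∂P) - K) with hx
  have hx0 : 0 ≤ x := hs_nonneg _
  set Db : Matrix (Fin d) (Fin d) ℝ := Matrix.of fun i j => ∫ ω in E, (A ω - K) i j ∂P with hDb
  have hT : (1 / P.real E) * ((1/2) * hsNorm (K⁻¹ * Db) ^ 2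
      + 2 * ((∫ ω in E, r ω ^ 2 ∂P) / l ^ 2) ^ 2) ≤
      (6/5) * κ ^ 2 * x ^ 2 + (1 / l ^ 4) * (24 * κ ^ 2 * l ^ 2 + 4) * s := by
    have hEm0 : 0 ≤ ∫ ω in E, r ω ^ 2 ∂P := integral_nonneg fun ω => sq_nonneg _
    rcases le_or_gt (1/2) (P.real E) with ht | ht
    · set Dc : Matrix (Fin d) (Fin d) ℝ := Matrix.of fun i j => ∫ ω in Eᶜ, (A ω - K) i j ∂P with hDc
      have hsplit : Db = ((Matrix.of fun i j => ∫ ω, A ω i j ∂P) - K) - Dc := by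
        ext i j
        have e1 := integral_add_compl hE (hD i j)
        have e2 : ∫ ω, (A ω - K) i j ∂P = (∫ ω, A ω i j ∂P) - K i j := by
          simp only [Matrix.sub_apply]
          rw [integral_sub (hAij i j) (integrable_const _)]; simp
        simp only [hDb, hDc, Matrix.of_apply, Matrix.sub_apply] at e1 e2 ⊢
        linarith
      have hy : hsNorm Dc ≤ 2 / l * m := by
        refine (hs_int_le _ _ (fun i j => (hD i j).integrableOn) hr1.integrableOn).trans ?_
        have b1 : ∫ ω in Eᶜ, r ω ∂P ≤ ∫ ω in Eᶜ, 2 / l * r ω ^ 2 ∂P := by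
          refine setIntegral_mono_on hr1.integrableOn (hr2.const_mul _).integrableOn hE.compl ?_
          intro ω hω
          have : l / 2 < r ω := not_le.1 hω
          have h0 := hr0 ω
          rw [div_mul_eq_mul_div, le_div_iff₀ hl]
          nlinarith
        refine b1.trans ?_
        rw [integral_const_mul]
        refine mul_le_mul_of_nonneg_left ?_ (by positivity)
        exact setIntegral_le_integral hr2 (Filter.Eventually.of_forall fun ω => sq_nonneg _)
      set y := hsNorm Dc with hyd
      have hy0 : 0 ≤ y := hs_nonneg _
      have hDbx : hsNorm (K⁻¹ * Db) ≤ κ * (x + y) := by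
        refine (hs_mul_le _ _).trans (mul_le_mul_of_nonneg_left ?_ hκ0)
        rw [hsplit]
        exact hs_sub_le _ _
      have hE2 : ∫ ω in E, r ω ^ 2 ∂P ≤ m :=
        setIntegral_le_integral hr2 (Filter.Eventually.of_forall fun ω => sq_nonneg _)
      exact main_real1 _ _ _ _ _ _ _ _ _ hl hx0 hy0 hs0 hm0 hκ0 (hs_nonneg _) hEm0
        (by linarith) hDbx hE2 hy hm4
    · have hc : (1/2:ℝ) ≤ P.real Eᶜ := by
        rw [probReal_compl_eq_one_sub hE]; linarith
      have hc2 : (1/2:ℝ) ≤ Real.sqrt (P.real Eᶜ) := Real.le_sqrt_of_sq_le (by linarith)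
      have hgoal := main_real2 κ x l s hl hs0 (hc2.trans hMk)
      rcases (measureReal_nonneg (μ := P) (s := E)).eq_or_lt with h0 | h0
      · rw [← h0]; simp only [div_zero, zero_mul]; exact le_trans (by norm_num) hgoal
      · have b1 : ∫ ω in E, r ω ∂P ≤ P.real E * (l / 2) := by
          have : ∫ ω in E, r ω ∂P ≤ ∫ ω in E, l / 2 ∂P :=
            setIntegral_mono_on hr1.integrableOn (integrable_const _) hE fun ω hω => hω
          simpa using this
        have b2 : ∫ ω in E, r ω ^ 2 ∂P ≤ P.real E * (l / 2) ^ 2 := by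
          have : ∫ ω in E, r ω ^ 2 ∂P ≤ ∫ ω in E, (l / 2) ^ 2 ∂P :=
            setIntegral_mono_on hr2.integrableOn (integrable_const _) hE
              fun ω hω => pow_le_pow_left₀ (hr0 ω) hω 2
          simpa using this
        have b3 : hsNorm (K⁻¹ * Db) ≤ P.real E * (1 / 2) := by
          refine (hs_inv_mul_le hd hK _).trans ?_
          rw [div_le_iff₀ hl]
          refine (hs_int_le _ _ (fun i j => (hD i j).integrableOn) hr1.integrableOn).trans ?_
          refine b1.trans (le_of_eq ?_)
          ring
        have b4 : (∫ ω in E, r ω ^ 2 ∂P) / l ^ 2 ≤ P.real E * (1 / 4) := by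
          rw [div_le_iff₀ (by positivity)]
          refine b2.trans (le_of_eq ?_)
          ring
        exact (main_real3 _ _ _ h0 ht (hs_nonneg _) (div_nonneg hEm0 (sq_nonneg _)) b3 b4).trans hgoal
  have := add_le_add hT hcompl
  refine this.trans (le_of_eq ?_)
  ring

lemma const_bound (hd : 1 ≤ d) {K : Matrix (Fin d) (Fin d) ℝ} (hK : K.PosDef) (x a b s : ℝ)
    (hs : 0 ≤ s) :
    (6/5) * hsNorm K⁻¹ ^ 2 * x ^ 2
    + (1 / lambdaMin K ^ 4) * (a + b + (24 * hsNorm K⁻¹ ^ 2 * lambdaMin K ^ 2 + 4)) * s ≤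
      (Real.sqrt 3 / (12 * Real.sqrt 2)) * Cfac d * hsNorm K⁻¹ ^ 2 * x ^ 2
      + (1 / lambdaMin K ^ 4) *
        ( a + b
        + (Real.sqrt 2 / Real.sqrt 3) * Cfac d * hsNorm K⁻¹ ^ 2 *
            (lambdaMin K ^ 2 + 4 * hsNorm K ^ 2)
        + Real.sqrt 70 * (d : ℝ) ^ 2 *
            ((1/2) * maxLog K + (Real.sqrt 2 + 1) * (d : ℝ) / 4)
        + (3 + Real.sqrt 3 / 8 + 5 * Real.sqrt 10 + 4 * Real.sqrt 30 / 3
            + Real.sqrt 15 / 3 + 10 * Real.sqrt 5 / 3) * (d : ℝ) ^ 2 ) * s := by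
  have hl := lam_pos hd hK
  have hlk := lam_le_hs hd hK
  have hd1 : (1:ℝ) ≤ d := by exact_mod_cast hd
  have s2l : (1.414:ℝ) ≤ Real.sqrt 2 := Real.le_sqrt_of_sq_le (by norm_num)
  have s2u : Real.sqrt 2 ≤ 1.415 := Real.sqrt_le_iff.2 (by norm_num)
  have s3l : (1.73:ℝ) ≤ Real.sqrt 3 := Real.le_sqrt_of_sq_le (by norm_num)
  have s3u : Real.sqrt 3 ≤ 1.74 := Real.sqrt_le_iff.2 (by norm_num)
  have s6l : (2.44:ℝ) ≤ Real.sqrt 6 := Real.le_sqrt_of_sq_le (by norm_num)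
  have sdl : (1:ℝ) ≤ Real.sqrt d := Real.le_sqrt_of_sq_le (by linarith)
  have s10 : (1:ℝ) ≤ Real.sqrt 10 := Real.le_sqrt_of_sq_le (by norm_num)
  have hC : 12 ≤ Cfac d := by unfold Cfac; linarith
  have q1 : (1/10 : ℝ) ≤ Real.sqrt 3 / (12 * Real.sqrt 2) := by
    rw [le_div_iff₀ (by positivity)]; linarith
  have q2 : (4/5 : ℝ) ≤ Real.sqrt 2 / Real.sqrt 3 := by
    rw [le_div_iff₀ (by positivity)]; linarith
  have p1 : (6/5 : ℝ) ≤ Real.sqrt 3 / (12 * Real.sqrt 2) * Cfac d := by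
    calc (6/5:ℝ) = (1/10) * 12 := by norm_num
      _ ≤ _ := by gcongr
  have p2 : (24/5 : ℝ) ≤ Real.sqrt 2 / Real.sqrt 3 * Cfac d := by
    calc (24/5:ℝ) ≤ (4/5) * 12 := by norm_num
      _ ≤ _ := by gcongr
  have p3 : 24 * hsNorm K⁻¹ ^ 2 * lambdaMin K ^ 2 ≤
      (Real.sqrt 2 / Real.sqrt 3) * Cfac d * hsNorm K⁻¹ ^ 2 * (lambdaMin K ^ 2 + 4 * hsNorm K ^ 2) := by
    calc 24 * hsNorm K⁻¹ ^ 2 * lambdaMin K ^ 2 =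
        (24/5) * hsNorm K⁻¹ ^ 2 * (lambdaMin K ^ 2 + 4 * lambdaMin K ^ 2) := by ring
      _ ≤ _ := by gcongr
  have p4 : 0 ≤ maxLog K := (abs_nonneg _).trans (le_max_left _ _)
  have p5 : 0 ≤ Real.sqrt 70 * (d : ℝ) ^ 2 *
            ((1/2) * maxLog K + (Real.sqrt 2 + 1) * (d : ℝ) / 4) := by positivity
  have p6 : 4 ≤ (3 + Real.sqrt 3 / 8 + 5 * Real.sqrt 10 + 4 * Real.sqrt 30 / 3
            + Real.sqrt 15 / 3 + 10 * Real.sqrt 5 / 3) * (d : ℝ) ^ 2 := by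
    have h30 := Real.sqrt_nonneg 30
    have h15 := Real.sqrt_nonneg 15
    have h5 := Real.sqrt_nonneg 5
    calc (4:ℝ) = 4 * 1 ^ 2 := by norm_num
      _ ≤ _ := by
        gcongr
        linarith
  gcongr ?_ * hsNorm K⁻¹ ^ 2 * x ^ 2 + _ * ?_ * s
  linarith

end Moments

lemma final_nonneg (q x l k u v s : ℝ) (hk : 0 ≤ k) (hl : 0 < l) (hu : 0 ≤ u) (hq : 0 ≤ q)
    (hv : 0 ≤ v) (hs : 0 ≤ s) :
    0 ≤ (6/5) * q ^ 2 * x ^ 2 + (1 / l ^ 4) * (8 * k * u + 8 * q * v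
      + (24 * q ^ 2 * l ^ 2 + 4)) * s := by
  positivity

/-- Theorem `final`: entropy bound for a conditionally Gaussian vector. -/
theorem statement_0
    {d : ℕ} (hd : 1 ≤ d)
    {Ω : Type*} [MeasurableSpace Ω] (P : Measure Ω) [IsProbabilityMeasure P]
    (K : Matrix (Fin d) (Fin d) ℝ) (hK : K.PosDef)
    (G F : Ω → Fin d → ℝ) (hG : Measure.map G P = gaussLaw K)
    (𝓕 : {m : MeasurableSpace Ω // m ≤ ‹MeasurableSpace Ω›})
    (A : Ω → Matrix (Fin d) (Fin d) ℝ)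
    (hFA : CondGaussian P F 𝓕.1 A)
    (hA8 : Integrable (fun ω => hsNorm (A ω) ^ 8) P)
    (hdet : P {ω | 0 < (A ω).det} = 1)
    (hAinv : Integrable (fun ω => hsNorm (A ω)⁻¹ ^ 2) P) :
    relEnt (Measure.map F P) (Measure.map G P) ≤
      (Real.sqrt 3 / (12 * Real.sqrt 2)) * Cfac d * hsNorm K⁻¹ ^ 2 *
        hsNorm ((Matrix.of fun i j => ∫ ω, A ω i j ∂P) - K) ^ 2
      + (1 / lambdaMin K ^ 4) *
        ( 8 * hsNorm K * Real.sqrt (∫ ω, hsNorm (A ω)⁻¹ ^ 2 ∂P)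
        + 8 * hsNorm K⁻¹ * Real.sqrt (∫ ω, hsNorm (A ω) ^ 2 ∂P)
        + (Real.sqrt 2 / Real.sqrt 3) * Cfac d * hsNorm K⁻¹ ^ 2 *
            (lambdaMin K ^ 2 + 4 * hsNorm K ^ 2)
        + Real.sqrt 70 * (d : ℝ) ^ 2 *
            ((1/2) * maxLog K + (Real.sqrt 2 + 1) * (d : ℝ) / 4)
        + (3 + Real.sqrt 3 / 8 + 5 * Real.sqrt 10 + 4 * Real.sqrt 30 / 3
            + Real.sqrt 15 / 3 + 10 * Real.sqrt 5 / 3) * (d : ℝ) ^ 2 ) *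
        Real.sqrt (∫ ω, hsNorm (A ω - K) ^ 8 ∂P) := by
  obtain ⟨hFi, -, hApsd, hAmeas, hcond⟩ := hFA
  rename_i mΩ _
  have hm𝓕 : 𝓕.1 ≤ mΩ := by
    by_contra hn
    have h0 := hcond 0
    rw [condExp_of_not_le hn] at h0
    obtain ⟨ω, hω⟩ := h0.exists
    simp at hω
  have hAm0 : Measurable (fun ω i j => A ω i j) := hAmeas.mono hm𝓕 le_rfl
  have hAm : ∀ i j, Measurable fun ω => A ω i j := fun i j =>
    (measurable_pi_iff.1 ((measurable_pi_iff.1 hAm0) i)) j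
  have hdm := meas_det hAm
  have hSet : MeasurableSet {ω | 0 < (A ω).det} := measurableSet_lt measurable_const hdm
  have hae : ∀ᵐ ω ∂P, 0 < (A ω).det := by
    rw [← prob_compl_eq_zero_iff hSet] at hdet
    exact hdet
  classical
  set B : Ω → Matrix (Fin d) (Fin d) ℝ := fun ω => if 0 < (A ω).det then A ω else K with hB
  have hBA : ∀ᵐ ω ∂P, B ω = A ω := by
    filter_upwards [hae] with ω hω
    simp [hB, hω]
  have hBm : ∀ i j, Measurable fun ω => B ω i j := by
    intro i j
    have e : (fun ω => B ω i j) = fun ω => if 0 < (A ω).det then A ω i j else K i j := by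
      ext ω; simp only [hB]; split_ifs <;> rfl
    rw [e]
    exact Measurable.ite hSet (hAm i j) measurable_const
  have hBp : ∀ ω, (B ω).PosDef := by
    intro ω
    simp only [hB]
    split_ifs with h
    · exact (hApsd ω).posDef_iff_det_ne_zero.2 h.ne'
    · exact hK
  have hB8 : Integrable (fun ω => hsNorm (B ω) ^ 8) P :=
    hA8.congr (hBA.mono fun ω h => by simp only [h])
  have hBinv : Integrable (fun ω => hsNorm (B ω)⁻¹ ^ 2) P :=
    hAinv.congr (hBA.mono fun ω h => by simp only [h])
  have e1 : ∫ ω, hsNorm (B ω)⁻¹ ^ 2 ∂P = ∫ ω, hsNorm (A ω)⁻¹ ^ 2 ∂P :=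
    integral_congr_ae (hBA.mono fun ω h => by simp only [h])
  have e2 : ∫ ω, hsNorm (B ω) ^ 2 ∂P = ∫ ω, hsNorm (A ω) ^ 2 ∂P :=
    integral_congr_ae (hBA.mono fun ω h => by simp only [h])
  have e3 : ∫ ω, hsNorm (B ω - K) ^ 8 ∂P = ∫ ω, hsNorm (A ω - K) ^ 8 ∂P :=
    integral_congr_ae (hBA.mono fun ω h => by simp only [h])
  have e4 : (Matrix.of fun i j => ∫ ω, B ω i j ∂P) = (Matrix.of fun i j => ∫ ω, A ω i j ∂P) := by
    ext i j
    exact integral_congr_ae (hBA.mono fun ω h => by simp only [h])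
  have hch : ∀ y : Fin d → ℝ, ∫ ω, Complex.exp (Complex.I * ((y ⬝ᵥ F ω : ℝ) : ℂ)) ∂P =
      ∫ ω, ((Real.exp (-(1/2) * (y ⬝ᵥ (B ω) *ᵥ y)) : ℝ) : ℂ) ∂P := by
    intro y
    rw [← integral_condExp hm𝓕]
    refine integral_congr_ae ?_
    filter_upwards [hcond y, hBA] with ω h1 h2
    rw [h1, h2]
  have hlaw := law_mix P hBm hBp F hFi.aestronglyMeasurable.aemeasurable hch
  have hpm : Measurable fun x => ∫ ω, gaussDensity (B ω) x ∂P := by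
    have : StronglyMeasurable fun x => ∫ ω, gaussDensity (B ω) x ∂P :=
      StronglyMeasurable.integral_prod_left (f := fun ω x => gaussDensity (B ω) x)
        (meas_gauss hBm).stronglyMeasurable
    exact this.measurable
  rw [hG, hlaw, relEnt_formula hK _ hpm
    (fun x => integral_nonneg fun ω => (gauss_pos (hBp ω) x).le)]
  refine le_trans ?_ (const_bound hd hK _ _ _ _ (Real.sqrt_nonneg _))
  by_cases hh : Integrable (fun x => (Real.log (∫ ω, gaussDensity (B ω) x ∂P)
      - Real.log (gaussDensity K x)) * ∫ ω, gaussDensity (B ω) x ∂P)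
  · have := core_bound hd P hK hBm hBp hB8 hBinv hh
    rw [e1, e2, e3, e4] at this
    exact this
  · rw [integral_undef hh]
    have hl := lam_pos hd hK
    exact final_nonneg _ _ _ _ _ _ _ (hs_nonneg K) hl (Real.sqrt_nonneg _)
      (hs_nonneg K⁻¹) (Real.sqrt_nonneg _) (Real.sqrt_nonneg _)
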